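/- arXiv:1612.08001 — 9 statements merged into one kernel-verified Lean document; each statement's English description precedes it below -/
import Mathlib

section
/- For all i ≠ j (i, j = 1, …, n) one has Γ_i Z^j = (h̃_{ij} + 1) h̃_{ij}^{−1} Z^j Γ_i and Γ_i ∂_j = (h̃_{ij} − 1) h̃_{ij}^{−1} ∂_j Γ_i. -/
open Finset


lemma aux_inv {A : Type*} [Ring A] {x p a b : A} (hx : IsUnit x) (hp : Commute p x) :
    a = p * Ring.inverse x * b ↔ x * a = p * b := by
  have e : x * (p * Ring.inverse x * b) = p * b := by
    rw [← mul_assoc, ← mul_assoc, ← hp.eq, mul_assoc p, Ring.mul_inverse_cancel x hx, mul_one]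
  constructor
  · intro h; rw [h, e]
  · intro h
    apply hx.mul_left_cancel
    rw [h, e]

lemma aux_inv2 {A : Type*} [Ring A] {x p a b : A} (hx : IsUnit x) (hp : Commute p x)
    (h : a = p * (Ring.inverse x) ^ 2 * b) : x * (x * a) = p * b := by
  have h1 : a = p * Ring.inverse x * (Ring.inverse x * b) := by
    rw [h]; noncomm_ring
  rw [(aux_inv hx hp).1 h1, ← mul_assoc, ← hp.eq, mul_assoc, ← mul_assoc x,
    Ring.mul_inverse_cancel x hx, one_mul]

/-- case `Z`, `i < j` -/
lemma aux1 {A : Type*} [Ring A] {x d z w : A} (h1 : IsUnit (x + 1))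
    (hd : d * x = (x + 1) * d) (hzw : x * (z * w) = (x + 1) * (w * z))
    (hwd : (x + 1) * ((x + 1) * (w * d)) = x * (x + 2) * (d * w)) :
    x * (d * z * w) = (x + 1) * (w * (d * z)) := by
  apply h1.mul_left_cancel
  have e1 : (x + 1) * (d * z * w) = (x + 2) * (d * w * z) := by
    calc (x + 1) * (d * z * w) = (x + 1) * d * (z * w) := by noncomm_ring
      _ = d * (x * (z * w)) := by rw [← hd]; noncomm_ring
      _ = (d * x + d) * (w * z) := by rw [hzw]; noncomm_ring
      _ = _ := by rw [hd]; noncomm_ring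
  calc (x + 1) * (x * (d * z * w)) = x * ((x + 1) * (d * z * w)) := by noncomm_ring
    _ = x * (x + 2) * (d * w) * z := by rw [e1]; noncomm_ring
    _ = _ := by rw [← hwd]; noncomm_ring

/-- case `Z`, `j < i` -/
lemma aux2 {A : Type*} [Ring A] {x d z w : A}
    (hd : d * x = (x + 1) * d) (hzw : x * (w * z) = (x - 1) * (z * w))
    (hwd : w * d = d * w) :
    x * (d * z * w) = (x + 1) * (w * (d * z)) := by
  calc x * (d * z * w) = (((x + 1) * d) - d) * (z * w) := by noncomm_ring
    _ = d * ((x - 1) * (z * w)) := by rw [← hd]; noncomm_ring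
    _ = (d * x) * (w * z) := by rw [← hzw]; noncomm_ring
    _ = (x + 1) * (d * w) * z := by rw [hd]; noncomm_ring
    _ = _ := by rw [← hwd]; noncomm_ring

/-- case `D`, `i < j` -/
lemma aux3 {A : Type*} [Ring A] {x d z w : A}
    (hdw : x * (d * w) = (x - 1) * (w * d)) (hzw : z * w = w * z) :
    x * (d * z * w) = (x - 1) * (w * (d * z)) := by
  calc x * (d * z * w) = x * (d * (z * w)) := by noncomm_ring
    _ = x * (d * w) * z := by rw [hzw]; noncomm_ring
    _ = _ := by rw [hdw]; noncomm_ring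

/-- case `D`, `j < i` -/
lemma aux4 {A : Type*} [Ring A] {x d z w : A} (h0 : IsUnit x)
    (hd : d * x = (x + 1) * d) (hdw : x * (w * d) = (x + 1) * (d * w))
    (hzw : (x - 1) * ((x - 1) * (z * w)) = x * (x - 2) * (w * z)) :
    x * (d * z * w) = (x - 1) * (w * (d * z)) := by
  apply h0.mul_left_cancel
  have s1 : d * (x - 1) = x * d := by rw [mul_sub, hd]; noncomm_ring
  have s2 : d * (x - 2) = (x - 1) * d := by rw [mul_sub, hd]; noncomm_ring
  calc x * (x * (d * z * w)) = x * (x * d) * (z * w) := by noncomm_ring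
    _ = (x * d) * (x - 1) * (z * w) := by rw [mul_assoc x d (x - 1), s1]
    _ = d * ((x - 1) * ((x - 1) * (z * w))) := by rw [← s1]; noncomm_ring
    _ = (d * x) * (x - 2) * (w * z) := by rw [hzw]; noncomm_ring
    _ = (x + 1) * (d * (x - 2)) * (w * z) := by rw [hd]; noncomm_ring
    _ = (x - 1) * ((x + 1) * (d * w)) * z := by rw [s2]; noncomm_ring
    _ = _ := by rw [← hdw]; noncomm_ring

/-- Lemma 2.1 (i) of Herlemont–Ogievetsky: in the ring `Diff_h(n)` of h-deformed
differential operators of type A, with `Γ_i = ∂_i Z^i`, one has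
`Γ_i Z^j = (h̃_ij + 1) h̃_ij⁻¹ Z^j Γ_i` and `Γ_i ∂_j = (h̃_ij − 1) h̃_ij⁻¹ ∂_j Γ_i`
for all `i ≠ j`. -/
theorem stmt0 {k A : Type*} [Field k] [CharZero k] [Ring A] [Algebra k A]
    {n : ℕ} (hn : 1 ≤ n) (h Z D : Fin n → A)
    (hcomm : ∀ i j, h i * h j = h j * h i)
    (hunit : ∀ (i j : Fin n) (m : ℤ), i ≠ j → IsUnit (h i - h j + (m : A)))
    (hhZ : ∀ i j, h i * Z j = Z j * (h i + if i = j then 1 else 0))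
    (hhD : ∀ i j, h i * D j = D j * (h i - if i = j then 1 else 0))
    (hZZ : ∀ i j, i < j →
      Z i * Z j = (h i - h j + 1) * Ring.inverse (h i - h j) * (Z j * Z i))
    (hDD : ∀ i j, i < j →
      D i * D j = (h i - h j - 1) * Ring.inverse (h i - h j) * (D j * D i))
    (hZD : ∀ i j, i < j → Z i * D j = D j * Z i)
    (hZD' : ∀ i j, j < i → Z i * D j =
      (h i - h j) * (h i - h j - 2) * (Ring.inverse (h i - h j - 1)) ^ 2 * (D j * Z i))
    (hZDdiag : ∀ i, Z i * D i =
      (∑ j, Ring.inverse (1 - (h i - h j)) * (D j * Z j)) - 1) :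
    ∀ i j, i ≠ j →
      (D i * Z i) * Z j = (h i - h j + 1) * Ring.inverse (h i - h j) * (Z j * (D i * Z i)) ∧
      (D i * Z i) * D j = (h i - h j - 1) * Ring.inverse (h i - h j) * (D j * (D i * Z i)) := by
  intro i j hij
  have hji : j ≠ i := hij.symm
  have hu : ∀ (i j : Fin n), i ≠ j → IsUnit (h i - h j) := fun i j hh => by
    simpa using hunit i j 0 hh
  have hu1 : ∀ (i j : Fin n), i ≠ j → IsUnit (h i - h j - 1) := fun i j hh => by
    simpa [sub_eq_add_neg] using hunit i j (-1) hh
  have hu2 : IsUnit (h i - h j + 1) := by simpa using hunit i j 1 hij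
  have c1 : ∀ x : A, Commute (x + 1) x := fun x => (Commute.refl x).add_left (Commute.one_left x)
  have c2 : ∀ x : A, Commute (x - 1) x := fun x => (Commute.refl x).sub_left (Commute.one_left x)
  have c3 : ∀ x : A, Commute (x * (x - 2)) (x - 1) := fun x => by
    unfold Commute SemiconjBy; noncomm_ring
  have hd : D i * (h i - h j) = (h i - h j + 1) * D i := by
    have a := hhD i i
    have b := hhD j i
    simp only [if_true, hji, if_false, sub_zero, mul_sub, mul_one] at a b
    rw [mul_sub, add_mul, sub_mul, a, b]; noncomm_ring
  rw [aux_inv (hu i j hij) (c1 _), aux_inv (hu i j hij) (c2 _)]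
  rcases lt_or_gt_of_ne hij with hlt | hlt
  · have p := (aux_inv (hu i j hij) (c1 _)).1 (hZZ i j hlt)
    have q := (aux_inv (hu i j hij) (c2 _)).1 (hDD i j hlt)
    have r := aux_inv2 (hu1 j i hji) (c3 _) (hZD' j i hlt)
    refine ⟨aux1 hu2 hd p ?_, aux3 q (hZD i j hlt)⟩
    have e : h j - h i = -(h i - h j) := by abel
    rw [e] at r
    generalize h i - h j = x at r
    calc _ = (-x - 1) * ((-x - 1) * (Z j * D i)) := by noncomm_ring
      _ = _ := by rw [r]; noncomm_ring
  · have p := (aux_inv (hu j i hji) (c1 _)).1 (hZZ j i hlt)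
    have q := (aux_inv (hu j i hji) (c2 _)).1 (hDD j i hlt)
    have r := aux_inv2 (hu1 i j hij) (c3 _) (hZD' i j hlt)
    have e : h j - h i = -(h i - h j) := by abel
    rw [e] at p q
    refine ⟨aux2 hd ?_ (hZD j i hlt), aux4 (hu i j hij) hd ?_ r⟩
    · generalize h i - h j = x at p
      calc _ = -(-x * (Z j * Z i)) := by noncomm_ring
        _ = _ := by rw [p]; noncomm_ring
    · generalize h i - h j = x at q
      calc _ = -(-x * (D j * D i)) := by noncomm_ring
        _ = _ := by rw [q]; noncomm_ring
end

section
/- For each i = 1, …, n−1 one has ((h̃_{i,i+1} − 1) h̃_{i,i+1}^{−1} ∂_{i+1}) (Z^{i+1} h̃_{i,i+1} (h̃_{i,i+1} − 1)^{−1}) = Γ_{i+1}; that is, the Zhelobenko operator q̌_i, which sends Z^i to −Z^{i+1} h̃_{i,i+1}(h̃_{i,i+1} − 1)^{−1} and ∂_i to −(h̃_{i,i+1} − 1) h̃_{i,i+1}^{−1} ∂_{i+1}, sends Γ_i = ∂_i Z^i to Γ_{i+1}. -/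
open Finset

theorem stmt1 {k A : Type*} [Field k] [CharZero k] [Ring A] [Algebra k A]
    {n : ℕ} (hn : 1 ≤ n) (h Z D : Fin n → A)
    (hcomm : ∀ i j, h i * h j = h j * h i)
    (hunit : ∀ (i j : Fin n) (m : ℤ), i ≠ j → IsUnit (h i - h j + (m : A)))
    (hhZ : ∀ i j, h i * Z j = Z j * (h i + if i = j then 1 else 0))
    (hhD : ∀ i j, h i * D j = D j * (h i - if i = j then 1 else 0))
    (hZZ : ∀ i j, i < j →
      Z i * Z j = (h i - h j + 1) * Ring.inverse (h i - h j) * (Z j * Z i))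
    (hDD : ∀ i j, i < j →
      D i * D j = (h i - h j - 1) * Ring.inverse (h i - h j) * (D j * D i))
    (hZD : ∀ i j, i < j → Z i * D j = D j * Z i)
    (hZD' : ∀ i j, j < i → Z i * D j =
      (h i - h j) * (h i - h j - 2) * (Ring.inverse (h i - h j - 1)) ^ 2 * (D j * Z i))
    (hZDdiag : ∀ i, Z i * D i =
      (∑ j, Ring.inverse (1 - (h i - h j)) * (D j * Z j)) - 1) :
    ∀ i j : Fin n, (i : ℕ) + 1 = (j : ℕ) →
      ((h i - h j - 1) * Ring.inverse (h i - h j) * D j) *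
        (Z j * ((h i - h j) * Ring.inverse (h i - h j - 1))) = D j * Z j := by
  intro i j hij
  have hne : i ≠ j := by
    rintro rfl
    omega
  have u0 : IsUnit (h i - h j) := by simpa using hunit i j 0 hne
  have u1 : IsUnit (h i - h j - 1) := by
    have := hunit i j (-1) hne
    simpa [sub_eq_add_neg] using this
  have xD : (h i - h j) * D j = D j * (h i - h j + 1) := by
    rw [sub_mul, hhD i j, hhD j j, if_neg hne, if_pos rfl, ← mul_sub]
    congr 1
    abel
  have xZ : (h i - h j + 1) * Z j = Z j * (h i - h j) := by
    rw [add_mul, sub_mul, hhZ i j, hhZ j j, if_neg hne, if_pos rfl, one_mul]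
    noncomm_ring
  have hP : (h i - h j) * (D j * Z j) = (D j * Z j) * (h i - h j) := by
    rw [← mul_assoc, xD, mul_assoc, xZ, mul_assoc]
  generalize h i - h j = x at *
  have e : (x - 1) * Ring.inverse x * D j * (Z j * (x * Ring.inverse (x - 1)))
      = (x - 1) * (Ring.inverse x * ((D j * Z j) * x)) * Ring.inverse (x - 1) := by
    simp only [mul_assoc]
  have hP1 : (x - 1) * (D j * Z j) = (D j * Z j) * (x - 1) := by
    rw [sub_mul, hP, mul_sub, one_mul, mul_one]
  rw [e, ← hP, Ring.inverse_mul_cancel_left _ _ u0, hP1, Ring.mul_inverse_cancel_right _ _ u1]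
end

section
/- The elements Γ_1, …, Γ_n pairwise commute: Γ_i Γ_j = Γ_j Γ_i for all i, j = 1, …, n. -/
open Finset

theorem semi_inv {A : Type*} [Ring A] {P b c : A} (hb : IsUnit b) (hc : IsUnit c)
    (e : SemiconjBy P b c) : SemiconjBy P (Ring.inverse b) (Ring.inverse c) := by
  obtain ⟨u, rfl⟩ := hb
  obtain ⟨v, rfl⟩ := hc
  rw [Ring.inverse_unit, Ring.inverse_unit]
  exact e.units_inv_right

theorem stmt2 {k A : Type*} [Field k] [CharZero k] [Ring A] [Algebra k A]
    {n : ℕ} (hn : 1 ≤ n) (h Z D : Fin n → A)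
    (hcomm : ∀ i j, h i * h j = h j * h i)
    (hunit : ∀ (i j : Fin n) (m : ℤ), i ≠ j → IsUnit (h i - h j + (m : A)))
    (hhZ : ∀ i j, h i * Z j = Z j * (h i + if i = j then 1 else 0))
    (hhD : ∀ i j, h i * D j = D j * (h i - if i = j then 1 else 0))
    (hZZ : ∀ i j, i < j →
      Z i * Z j = (h i - h j + 1) * Ring.inverse (h i - h j) * (Z j * Z i))
    (hDD : ∀ i j, i < j →
      D i * D j = (h i - h j - 1) * Ring.inverse (h i - h j) * (D j * D i))
    (hZD : ∀ i j, i < j → Z i * D j = D j * Z i)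
    (hZD' : ∀ i j, j < i → Z i * D j =
      (h i - h j) * (h i - h j - 2) * (Ring.inverse (h i - h j - 1)) ^ 2 * (D j * Z i))
    (hZDdiag : ∀ i, Z i * D i =
      (∑ j, Ring.inverse (1 - (h i - h j)) * (D j * Z j)) - 1) :
    ∀ i j, (D i * Z i) * (D j * Z j) = (D j * Z j) * (D i * Z i) := by
  have key : ∀ i j, i < j → (D i * Z i) * (D j * Z j) = (D j * Z j) * (D i * Z i) := by
    intro i j hij
    have hne : i ≠ j := ne_of_lt hij
    have hne' : j ≠ i := hne.symm
    have ua : IsUnit (h i - h j) := by simpa using hunit i j 0 hne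
    have ub : IsUnit (h j - h i) := by simpa using hunit j i 0 hne'
    have ub1 : IsUnit (h j - h i - 1) := by
      simpa [sub_eq_add_neg] using hunit j i (-1) hne'
    have e1 := hhD i i
    have e2 := hhD i j
    have e3 := hhD j i
    have e4 := hhD j j
    simp only [if_true, if_neg hne, if_neg hne', sub_zero] at e1 e2 e3 e4
    have s0 : SemiconjBy (D j) (h j - h i - 1) (h j - h i) := by
      unfold SemiconjBy
      rw [sub_mul, e4, e2]; noncomm_ring
    have s1 : SemiconjBy (D j) (h j - h i) (h j - h i + 1) := by
      have := s0.add_right (SemiconjBy.one_right (D j))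
      simpa using this
    have s2 : SemiconjBy (D j) (h j - h i - 2) (h j - h i - 1) := by
      have := s0.sub_right (SemiconjBy.one_right (D j))
      rwa [sub_sub, one_add_one_eq_two] at this
    have s3 := semi_inv ub1 ub s0
    have S := ((s1.mul_right s2).mul_right (s3.pow_right 2)).eq
    have c0 : SemiconjBy (D j * D i) (h i - h j) (h i - h j) := by
      have t : SemiconjBy (D i) (h i - h j) (h i - h j + 1) := by
        unfold SemiconjBy
        rw [add_mul, sub_mul, e1, e3]; noncomm_ring
      have t' : SemiconjBy (D j) (h i - h j + 1) (h i - h j) := by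
        unfold SemiconjBy
        rw [sub_mul, e2, e4]; noncomm_ring
      exact t'.mul_left t
    have c1 := semi_inv ua ua c0
    have C := ((c0.add_right (SemiconjBy.one_right _)).mul_right c1).eq
    have L : (D i * Z i) * (D j * Z j) = ((h i - h j - 1) * Ring.inverse (h i - h j) *
        ((h i - h j + 1) * Ring.inverse (h i - h j))) * (D j * D i * (Z j * Z i)) := by
      calc (D i * Z i) * (D j * Z j) = D i * (Z i * D j) * Z j := by noncomm_ring
        _ = (D i * D j) * (Z i * Z j) := by rw [hZD i j hij]; noncomm_ring
        _ = (h i - h j - 1) * Ring.inverse (h i - h j) * ((D j * D i) *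
            ((h i - h j + 1) * Ring.inverse (h i - h j))) * (Z j * Z i) := by
          rw [hDD i j hij, hZZ i j hij]; simp only [mul_assoc]
        _ = _ := by rw [C]; simp only [mul_assoc]
    have R : (D j * Z j) * (D i * Z i) = ((h j - h i + 1) * (h j - h i - 1) *
        (Ring.inverse (h j - h i)) ^ 2) * (D j * D i * (Z j * Z i)) := by
      calc (D j * Z j) * (D i * Z i) = D j * (Z j * D i) * Z i := by simp only [mul_assoc]
        _ = (D j * ((h j - h i) * (h j - h i - 2) * (Ring.inverse (h j - h i - 1)) ^ 2)) *
            (D i * (Z j * Z i)) := by rw [hZD' j i hij]; simp only [mul_assoc]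
        _ = _ := by rw [S]; simp only [mul_assoc]
    rw [L, R]
    congr 1
    have hba : h j - h i = -(h i - h j) := by abel
    rw [hba]
    generalize h i - h j = a at ua
    obtain ⟨u, rfl⟩ := ua
    rw [← Units.val_neg, Ring.inverse_unit, Ring.inverse_unit, inv_neg, Units.val_neg,
      Units.val_neg, neg_sq, sq]
    have q : (↑u⁻¹ : A) * (↑u + 1) = (↑u + 1) * ↑u⁻¹ := by
      rw [mul_add, add_mul]; simp
    rw [mul_assoc, ← mul_assoc (↑u⁻¹ : A), q]
    noncomm_ring
  intro i j
  rcases lt_trichotomy i j with hij | rfl | hij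
  · exact key i j hij
  · rfl
  · exact (key j i hij).symm
end

section
/- The following three conditions are equivalent: (a) Ž^i Ž^j = (ȟ_{ij} + 1) ȟ_{ij}^{−1} Ž^j Ž^i for all i < j; (b) the elements ψ̌_i Ž^i, i = 1, …, n, pairwise commute; (c) the elements Ž^i ψ̌'_i, i = 1, …, n, pairwise commute. -/
open Finset

/-- Ordered product of a family of (commuting) ring elements over a finite set of indices. -/
def oprod {A : Type*} [Monoid A] {n : ℕ} (s : Finset (Fin n)) (f : Fin n → A) : A :=
  ((s.sort (· ≤ ·)).map f).prod

theorem oprod_commute {A : Type*} [Monoid A] {n : ℕ} (s : Finset (Fin n)) (f : Fin n → A) (x : A)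
    (H : ∀ m ∈ s, Commute x (f m)) : Commute x (oprod s f) := by
  unfold oprod
  apply Commute.list_prod_right
  intro y hy
  simp only [List.mem_map, Finset.mem_sort] at hy
  obtain ⟨m, hm, rfl⟩ := hy
  exact H m hm

theorem oprod_isUnit {A : Type*} [Monoid A] {n : ℕ} (s : Finset (Fin n)) (f : Fin n → A)
    (H : ∀ m ∈ s, IsUnit (f m)) : IsUnit (oprod s f) := by
  unfold oprod
  apply List.prod_isUnit
  intro y hy
  simp only [List.mem_map, Finset.mem_sort] at hy
  obtain ⟨m, hm, rfl⟩ := hy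
  exact H m hm

theorem oprod_erase {A : Type*} [Monoid A] {n : ℕ} (s : Finset (Fin n)) (f : Fin n → A)
    (H : ∀ a b, Commute (f a) (f b)) (j : Fin n) (hj : j ∈ s) :
    oprod s f = f j * oprod (s.erase j) f := by
  have key : ∀ t : Finset (Fin n), oprod t f = t.noncommProd f (fun a _ b _ _ => H a b) := by
    intro t
    unfold oprod
    rw [← Finset.noncommProd_toFinset (t.sort (· ≤ ·)) f (fun a _ b _ _ => H a b)
      (Finset.sort_nodup _ _)]
    simp only [Finset.sort_toFinset]
  rw [key, key]
  exact (Finset.mul_noncommProd_erase s hj f (fun a _ b _ _ => H a b)).symm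

theorem a_iff {A : Type*} [Ring A] (x u v : A) (hx : IsUnit x) :
    u = (x + 1) * Ring.inverse x * v ↔ x * u = (x + 1) * v := by
  have h1 := Ring.mul_inverse_cancel x hx
  have h2 := Ring.inverse_mul_cancel x hx
  have e : x * ((x + 1) * Ring.inverse x * v) = (x + 1) * v := by
    calc _ = (x + 1) * (x * Ring.inverse x) * v := by noncomm_ring
      _ = _ := by rw [h1, mul_one]
  rw [← e]
  exact hx.mul_right_inj.symm

theorem b_iff {A : Type*} [Ring A] (x P Q zi zj : A) (hP : IsUnit P) (hQ : IsUnit Q)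
    (hQx : Commute Q x) (hQP : Commute Q P) (hPx : Commute P x) (hQz : Commute Q zi)
    (hPz : Commute P zj) (hxz : zj * x = (x + 1) * zj) :
    x * (zi * zj) = (x + 1) * (zj * zi) ↔
      ((x * P) * zi) * (Q * zj) = (Q * zj) * ((x * P) * zi) := by
  have e1 : ((x * P) * zi) * (Q * zj) = (Q * P) * (x * (zi * zj)) := by
    calc _ = x * P * (zi * Q) * zj := by noncomm_ring
      _ = x * (P * Q) * zi * zj := by rw [← hQz.eq]; noncomm_ring
      _ = (x * Q) * P * zi * zj := by rw [← hQP.eq]; noncomm_ring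
      _ = Q * (x * P) * zi * zj := by rw [← hQx.eq]; noncomm_ring
      _ = _ := by rw [← hPx.eq]; noncomm_ring
  have e2 : (Q * zj) * ((x * P) * zi) = (Q * P) * ((x + 1) * (zj * zi)) := by
    calc _ = Q * (zj * x) * P * zi := by noncomm_ring
      _ = Q * (x + 1) * (zj * P) * zi := by rw [hxz]; noncomm_ring
      _ = Q * ((x + 1) * P) * zj * zi := by rw [← hPz.eq]; noncomm_ring
      _ = _ := by rw [← (hPx.add_right (Commute.one_right P)).eq]; noncomm_ring
  rw [e1, e2]
  exact (hQ.mul hP).mul_right_inj.symm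

-- here x is h j - h i
theorem c_iff {A : Type*} [Ring A] (x P Q zi zj : A) (hP : IsUnit P) (hQ : IsUnit Q)
    (hQP : Commute Q P) (hQx : Commute Q x) (hQz : Commute Q zj)
    (hPz : Commute P zi) (hxi : x * zi = zi * (x - 1)) (hxj : x * zj = zj * (x + 1)) :
    -x * (zi * zj) = (-x + 1) * (zj * zi) ↔
      (zi * Q) * (zj * (x * P)) = (zj * (x * P)) * (zi * Q) := by
  have e1 : (zi * Q) * (zj * (x * P)) = (x * (zi * zj)) * (Q * P) := by
    calc _ = zi * (Q * zj) * x * P := by noncomm_ring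
      _ = zi * zj * (Q * x) * P := by rw [hQz.eq]; noncomm_ring
      _ = zi * (zj * (x + 1) - zj) * Q * P := by rw [hQx.eq]; noncomm_ring
      _ = (zi * (x - 1)) * zj * Q * P := by rw [← hxj]; noncomm_ring
      _ = _ := by rw [← hxi]; noncomm_ring
  have e2 : (zj * (x * P)) * (zi * Q) = ((x - 1) * (zj * zi)) * (Q * P) := by
    calc _ = zj * x * (P * zi) * Q := by noncomm_ring
      _ = zj * (x * zi) * (P * Q) := by rw [hPz.eq]; noncomm_ring
      _ = (zj * (x + 1) - zj) * zi * (Q * P) := by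
        rw [← hQP.eq]
        have : zj * (x + 1) - zj = zj * x := by noncomm_ring
        rw [this]; noncomm_ring
      _ = _ := by rw [← hxj]; noncomm_ring
  rw [e1, e2, (hQ.mul hP).mul_left_inj]
  have e3 : (-x + 1) * (zj * zi) = -((x - 1) * (zj * zi)) := by noncomm_ring
  rw [e3, neg_mul, neg_inj]

theorem sym_iff {n : ℕ} (R : Fin n → Fin n → Prop) (S : Fin n → Fin n → Prop)
    (hr : ∀ i, R i i) (hs : ∀ i j, R i j → R j i) (H : ∀ i j, i < j → (S i j ↔ R i j)) :
    (∀ i j, i < j → S i j) ↔ ∀ i j, R i j := by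
  constructor
  · intro h i j
    rcases lt_trichotomy i j with h1 | h1 | h1
    · exact (H i j h1).1 (h i j h1)
    · subst h1; exact hr i
    · exact hs _ _ ((H j i h1).1 (h j i h1))
  · intro h i j hij
    exact (H i j hij).2 (h i j)

/-- Lemma 2.2 (i) of Herlemont–Ogievetsky: for elements `Ž^1, …, Ž^n` of weight `+ε_i`
with respect to a commuting family `ȟ_1, …, ȟ_n` (with `ȟ_ij = ȟ_i − ȟ_j` invertible for
`i ≠ j`, `ψ̌_i = Π_{k>i} ȟ_ik`, `ψ̌'_i = Π_{k<i} ȟ_ik`), the relations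
`Ž^i Ž^j = (ȟ_ij + 1) ȟ_ij⁻¹ Ž^j Ž^i` for `i < j` hold if and only if the family
`{ψ̌_i Ž^i}` is commutative, if and only if the family `{Ž^i ψ̌'_i}` is commutative. -/
theorem stmt3 {k A : Type*} [Field k] [CharZero k] [Ring A] [Algebra k A]
    {n : ℕ} (hn : 1 ≤ n) (h Z : Fin n → A)
    (hcomm : ∀ i j, h i * h j = h j * h i)
    (hunit : ∀ i j : Fin n, i ≠ j → IsUnit (h i - h j))
    (hhZ : ∀ i j, h i * Z j = Z j * (h i + if i = j then 1 else 0)) :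
    ((∀ i j, i < j →
        Z i * Z j = (h i - h j + 1) * Ring.inverse (h i - h j) * (Z j * Z i)) ↔
      (∀ i j, (oprod (Finset.univ.filter fun m => i < m) (fun m => h i - h m) * Z i) *
              (oprod (Finset.univ.filter fun m => j < m) (fun m => h j - h m) * Z j) =
              (oprod (Finset.univ.filter fun m => j < m) (fun m => h j - h m) * Z j) *
              (oprod (Finset.univ.filter fun m => i < m) (fun m => h i - h m) * Z i))) ∧
    ((∀ i j, i < j →
        Z i * Z j = (h i - h j + 1) * Ring.inverse (h i - h j) * (Z j * Z i)) ↔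
      (∀ i j, (Z i * oprod (Finset.univ.filter fun m => m < i) (fun m => h i - h m)) *
              (Z j * oprod (Finset.univ.filter fun m => m < j) (fun m => h j - h m)) =
              (Z j * oprod (Finset.univ.filter fun m => m < j) (fun m => h j - h m)) *
              (Z i * oprod (Finset.univ.filter fun m => m < i) (fun m => h i - h m)))) := by
  have hc : ∀ i j, Commute (h i) (h j) := hcomm
  have hd : ∀ a b c d, Commute (h a - h b) (h c - h d) := fun a b c d =>
    ((hc a c).sub_right (hc a d)).sub_left ((hc b c).sub_right (hc b d))
  have hz : ∀ i j, i ≠ j → Commute (h i) (Z j) := by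
    intro i j hij
    have := hhZ i j
    rw [if_neg hij, add_zero] at this
    exact this
  have hz1 : ∀ i, h i * Z i = Z i * h i + Z i := by
    intro i
    have := hhZ i i
    rwa [if_pos rfl, mul_add, mul_one] at this
  have hdz : ∀ a b j, a ≠ j → b ≠ j → Commute (Z j) (h a - h b) := fun a b j ha hb =>
    ((hz a j ha).symm).sub_right (hz b j hb).symm
  constructor
  · refine sym_iff _ _ (fun i => rfl) (fun i j e => e.symm) ?_
    intro i j hij
    rw [a_iff _ _ _ (hunit i j hij.ne)]
    rw [oprod_erase (Finset.univ.filter fun m => i < m) (fun m => h i - h m)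
      (fun a b => hd _ _ _ _) j (by simpa using hij)]
    apply b_iff
    · apply oprod_isUnit
      intro m hm
      simp only [Finset.mem_erase, Finset.mem_filter, Finset.mem_univ, true_and] at hm
      exact hunit _ _ hm.2.ne
    · apply oprod_isUnit
      intro m hm
      simp only [Finset.mem_filter, Finset.mem_univ, true_and] at hm
      exact hunit _ _ hm.ne
    · exact (oprod_commute _ _ _ (fun m _ => hd _ _ _ _)).symm
    · exact oprod_commute _ _ _ (fun m _ => (oprod_commute _ _ _ (fun m' _ => hd _ _ _ _)).symm)
    · exact (oprod_commute _ _ _ (fun m _ => hd _ _ _ _)).symm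
    · refine (oprod_commute _ _ _ (fun m hm => ?_)).symm
      simp only [Finset.mem_filter, Finset.mem_univ, true_and] at hm
      exact hdz _ _ _ hij.ne' (hij.trans hm).ne'
    · refine (oprod_commute _ _ _ (fun m hm => ?_)).symm
      simp only [Finset.mem_erase, Finset.mem_filter, Finset.mem_univ, true_and] at hm
      exact hdz _ _ _ hij.ne hm.1
    · have e1 := hz1 j
      have e2 := (hz i j hij.ne).eq
      rw [add_mul, sub_mul, e1, e2, mul_sub]
      noncomm_ring
  · refine sym_iff _ _ (fun i => rfl) (fun i j e => e.symm) ?_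
    intro i j hij
    rw [a_iff _ _ _ (hunit i j hij.ne)]
    rw [oprod_erase (Finset.univ.filter fun m => m < j) (fun m => h j - h m)
      (fun a b => hd _ _ _ _) i (by simpa using hij)]
    rw [← neg_sub (h j) (h i)]
    apply c_iff
    · apply oprod_isUnit
      intro m hm
      simp only [Finset.mem_erase, Finset.mem_filter, Finset.mem_univ, true_and] at hm
      exact hunit _ _ hm.2.ne'
    · apply oprod_isUnit
      intro m hm
      simp only [Finset.mem_filter, Finset.mem_univ, true_and] at hm
      exact hunit _ _ hm.ne'
    · exact oprod_commute _ _ _ (fun m _ => (oprod_commute _ _ _ (fun m' _ => hd _ _ _ _)).symm)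
    · exact (oprod_commute _ _ _ (fun m _ => hd _ _ _ _)).symm
    · refine (oprod_commute _ _ _ (fun m hm => ?_)).symm
      simp only [Finset.mem_filter, Finset.mem_univ, true_and] at hm
      exact hdz _ _ _ hij.ne (hm.trans hij).ne
    · refine (oprod_commute _ _ _ (fun m hm => ?_)).symm
      simp only [Finset.mem_erase, Finset.mem_filter, Finset.mem_univ, true_and] at hm
      exact hdz _ _ _ hij.ne' hm.1
    · have e1 := hz1 i
      have e2 := (hz j i hij.ne').eq
      rw [sub_mul, e1, e2]
      noncomm_ring
    · have e1 := hz1 j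
      have e2 := (hz i j hij.ne).eq
      rw [sub_mul, e1, e2]
      noncomm_ring
end

section
/- The n × n matrix V with entries V_{kj} = ∂e_j/∂x_k (the partial derivative of the j-th elementary symmetric polynomial e_j in x_1, …, x_n with respect to x_k, i.e. the elementary symmetric polynomial e_{j−1} in the n−1 variables x_l, l ≠ k) is invertible, and its inverse has entries (V^{−1})_{ji} = (−1)^{j−1} x_i^{n−j} / Π_{k ≠ i}(x_i − x_k). -/
open Finset

theorem prod_sub_expand {K ι : Type*} [Field K] [DecidableEq ι] (S : Finset ι) (x : ι → K) (t : K) :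
    ∏ l ∈ S, (t - x l) = ∑ j ∈ Finset.range (S.card + 1),
      (-1 : K) ^ j * t ^ (S.card - j) * ∑ s ∈ S.powersetCard j, ∏ i ∈ s, x i := by
  have h : ∀ l ∈ S, t - x l = -x l + t := fun l _ => by ring
  rw [Finset.prod_congr rfl h, Finset.prod_add, Finset.sum_powerset]
  refine Finset.sum_congr rfl fun j _ => ?_
  rw [Finset.mul_sum]
  refine Finset.sum_congr rfl fun s hs => ?_
  obtain ⟨h1, h2⟩ := Finset.mem_powersetCard.mp hs
  rw [Finset.prod_neg, Finset.prod_const, Finset.card_sdiff_of_subset h1, h2]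
  ring


/-- Lemma 3.2 (i) of Herlemont–Ogievetsky: for pairwise distinct `x_1, …, x_n` in a field
of characteristic 0, the matrix `V` with `V_{kj} = ∂e_j/∂x_k` (the elementary symmetric
polynomial of degree `j − 1` in the variables `x_l`, `l ≠ k`) is invertible, with inverse
`(V⁻¹)_{ji} = (−1)^{j−1} x_i^{n−j} / Π_{k ≠ i}(x_i − x_k)`.
(Here the `Fin n` index `j` corresponds to the classical index `j + 1 ∈ {1, …, n}`.) -/
theorem stmt6 {K : Type*} [Field K] [CharZero K] {n : ℕ} (hn : 1 ≤ n)
    (x : Fin n → K) (hx : ∀ i j : Fin n, i ≠ j → x i ≠ x j) :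
    ∀ V W : Matrix (Fin n) (Fin n) K,
      (∀ k j, V k j = ∑ s ∈ (Finset.univ.erase k).powersetCard (j : ℕ), ∏ i ∈ s, x i) →
      (∀ j i, W j i = (-1 : K) ^ (j : ℕ) * x i ^ (n - 1 - (j : ℕ)) /
        ∏ l ∈ Finset.univ.erase i, (x i - x l)) →
      V * W = 1 ∧ W * V = 1 := by
  intro V W hV hW
  have key : V * W = 1 := by
    ext k i
    have hcard : (Finset.univ.erase k : Finset (Fin n)).card = n - 1 := by simp
    have h1 := prod_sub_expand (Finset.univ.erase k) x (x i)
    rw [hcard, Nat.sub_add_cancel hn, ← Fin.sum_univ_eq_sum_range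
      (fun j => (-1 : K) ^ j * (x i) ^ (n - 1 - j) *
      ∑ s ∈ (Finset.univ.erase k).powersetCard j, ∏ i ∈ s, x i)] at h1
    have h2 : (V * W) k i = (∏ l ∈ Finset.univ.erase k, (x i - x l)) /
        ∏ l ∈ Finset.univ.erase i, (x i - x l) := by
      rw [h1, Matrix.mul_apply, Finset.sum_div]
      refine Finset.sum_congr rfl fun j _ => ?_
      rw [hV, hW]
      ring
    rw [h2]
    by_cases hki : k = i
    · subst hki
      rw [Matrix.one_apply_eq]
      refine div_self (Finset.prod_ne_zero_iff.mpr fun l hl => ?_)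
      exact sub_ne_zero.mpr (hx _ _ (Finset.ne_of_mem_erase hl).symm)
    · rw [Matrix.one_apply_ne hki, Finset.prod_eq_zero (i := i), zero_div]
      · simp [Ne.symm hki]
      · simp
  exact ⟨key, mul_eq_one_comm.mp key⟩
end

section
/- For each j = 1, …, n one has χ_j Γ_j = h̃_j^n + Σ_{k=1}^n (−1)^{k−1} c_k h̃_j^{n−k}. -/
open Finset

theorem oprod_map {A S : Type*} [Ring A] [CommRing S] (φ : S →+* A) {n : ℕ}
    (s : Finset (Fin n)) (f : Fin n → S) :
    oprod s (fun i => φ (f i)) = φ (∏ i ∈ s, f i) := by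
  have h1 : ∏ i ∈ s, f i = ((s.sort (· ≤ ·)).map f).prod := by
    rw [Finset.prod_eq_multiset_prod, ← Multiset.prod_coe, ← Multiset.map_coe, Finset.sort_eq]
  rw [h1, map_list_prod, List.map_map]
  rfl

theorem prod_expand {S ι : Type*} [CommRing S] [DecidableEq ι] (s : Finset ι) (g : ι → S) (x : S) :
    ∏ i ∈ s, (x - g i) = ∑ m ∈ Finset.range (s.card + 1),
      (-1) ^ m * (∑ t ∈ s.powersetCard m, ∏ i ∈ t, g i) * x ^ (s.card - m) := by
  simp_rw [sub_eq_neg_add]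
  rw [Finset.prod_add, Finset.sum_powerset]
  refine Finset.sum_congr rfl fun m _ => ?_
  rw [Finset.mul_sum, Finset.sum_mul]
  refine Finset.sum_congr rfl fun t ht => ?_
  rw [Finset.mem_powersetCard] at ht
  rw [Finset.prod_neg, Finset.prod_const, Finset.card_sdiff_of_subset ht.1, ht.2]

theorem key {A S : Type*} [Ring A] [CommRing S] (φ : S →+* A) {n : ℕ} (hn : 1 ≤ n)
    (g : Fin n → S) (G : Fin n → A) (hG : ∀ i j, φ (g i) * G j = G j * φ (g i))
    (c : ℕ → A)
    (hc : ∀ K : ℕ, c K = (∑ j, (∑ s ∈ (Finset.univ.erase j).powersetCard (K - 1),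
        oprod s (fun i => φ (g i))) * G j) -
          ∑ s ∈ Finset.univ.powersetCard K, oprod s (fun i => φ (g i))) (j : Fin n) :
    oprod (Finset.univ.erase j) (fun l => φ (g j) - φ (g l)) * G j =
        φ (g j) ^ n +
          ∑ K ∈ Finset.range n, (-1 : A) ^ K * c (K + 1) * φ (g j) ^ (n - (K + 1)) := by
  have hpow : ∀ i m, G i * φ (g j) ^ m = φ (g j) ^ m * G i := fun i m =>
    (Commute.pow_right (show Commute (G i) (φ (g j)) from (hG j i).symm) m).eq
  have hterm : ∀ K, (-1 : A) ^ K * c (K + 1) * φ (g j) ^ (n - (K + 1)) =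
      (∑ i, φ ((-1) ^ K * (∑ s ∈ (Finset.univ.erase i).powersetCard K, ∏ l ∈ s, g l)
        * g j ^ (n - 1 - K)) * G i) +
      φ ((-1) ^ (K + 1) * (∑ s ∈ Finset.univ.powersetCard (K + 1), ∏ l ∈ s, g l)
        * g j ^ (n - (K + 1))) := by
    intro K
    rw [hc]
    simp only [oprod_map, Nat.add_sub_cancel, ← map_sum]
    rw [mul_sub, sub_mul, Finset.mul_sum, Finset.sum_mul, sub_eq_add_neg]
    congr 1
    · refine Finset.sum_congr rfl fun i _ => ?_
      rw [show n - 1 - K = n - (K + 1) by omega]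
      simp only [map_mul, map_pow, map_neg, map_one, mul_assoc, hpow]
    · simp only [map_mul, map_pow, map_neg, map_one, pow_succ, mul_neg, mul_one, neg_mul]
  rw [Finset.sum_congr rfl fun K _ => hterm K, Finset.sum_add_distrib, Finset.sum_comm]
  have h1 : ∀ i : Fin n, ∑ K ∈ Finset.range n,
      φ ((-1) ^ K * (∑ s ∈ (Finset.univ.erase i).powersetCard K, ∏ l ∈ s, g l)
        * g j ^ (n - 1 - K)) * G i = φ (∏ l ∈ Finset.univ.erase i, (g j - g l)) * G i := by
    intro i
    rw [← Finset.sum_mul, ← map_sum, prod_expand]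
    have : (Finset.univ.erase i).card = n - 1 := by simp
    rw [this, show n - 1 + 1 = n by omega]
  have h2 : φ (g j) ^ n + ∑ K ∈ Finset.range n,
      φ ((-1) ^ (K + 1) * (∑ s ∈ Finset.univ.powersetCard (K + 1), ∏ l ∈ s, g l)
        * g j ^ (n - (K + 1))) = 0 := by
    rw [← map_sum, ← map_pow, ← map_add]
    have h3 := prod_expand Finset.univ g (g j)
    rw [Finset.prod_eq_zero (Finset.mem_univ j) (sub_self _), Finset.sum_range_succ'] at h3
    simp only [Finset.card_univ, Fintype.card_fin] at h3
    rw [show g j ^ n + _ = 0 from ?_, map_zero]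
    rw [h3, add_comm]
    simp
  rw [Finset.sum_congr rfl fun i _ => h1 i, add_left_comm, h2, add_zero]
  rw [Finset.sum_eq_single j]
  · simp only [← map_sub, oprod_map]
  · intro i _ hij
    rw [Finset.prod_eq_zero (i := j) (by simp [hij.symm]) (sub_self _)]
    simp
  · simp

theorem stmt7 {k A : Type*} [Field k] [CharZero k] [Ring A] [Algebra k A]
    {n : ℕ} (hn : 1 ≤ n) (h Z D : Fin n → A)
    (hcomm : ∀ i j, h i * h j = h j * h i)
    (hunit : ∀ (i j : Fin n) (m : ℤ), i ≠ j → IsUnit (h i - h j + (m : A)))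
    (hhZ : ∀ i j, h i * Z j = Z j * (h i + if i = j then 1 else 0))
    (hhD : ∀ i j, h i * D j = D j * (h i - if i = j then 1 else 0))
    (hZZ : ∀ i j, i < j →
      Z i * Z j = (h i - h j + 1) * Ring.inverse (h i - h j) * (Z j * Z i))
    (hDD : ∀ i j, i < j →
      D i * D j = (h i - h j - 1) * Ring.inverse (h i - h j) * (D j * D i))
    (hZD : ∀ i j, i < j → Z i * D j = D j * Z i)
    (hZD' : ∀ i j, j < i → Z i * D j =
      (h i - h j) * (h i - h j - 2) * (Ring.inverse (h i - h j - 1)) ^ 2 * (D j * Z i))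
    (hZDdiag : ∀ i, Z i * D i =
      (∑ j, Ring.inverse (1 - (h i - h j)) * (D j * Z j)) - 1) :
    ∀ c : ℕ → A,
      (∀ K : ℕ, c K = (∑ j, (∑ s ∈ (Finset.univ.erase j).powersetCard (K - 1), oprod s h) * (D j * Z j)) -
          ∑ s ∈ Finset.univ.powersetCard K, oprod s h) →
      ∀ j, oprod (Finset.univ.erase j) (fun l => h j - h l) * (D j * Z j) =
        h j ^ n + ∑ K ∈ Finset.range n, (-1 : A) ^ K * c (K + 1) * h j ^ (n - (K + 1)) := by
  intro c hc j
  letI : CommRing (Subring.closure (Set.range h)) :=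
    Subring.closureCommRingOfComm (by
      rintro _ ⟨i, rfl⟩ _ ⟨j, rfl⟩
      exact hcomm i j)
  let φ : Subring.closure (Set.range h) →+* A :=
    { toFun := fun x => x.1
      map_one' := rfl
      map_mul' := fun _ _ => rfl
      map_zero' := rfl
      map_add' := fun _ _ => rfl }
  refine key φ hn (fun i => ⟨h i, Subring.subset_closure ⟨i, rfl⟩⟩) (fun i => D i * Z i) ?_ c hc j
  intro i j
  change h i * (D j * Z j) = D j * Z j * h i
  rw [← mul_assoc, hhD, mul_assoc, sub_mul, hhZ, mul_assoc]
  split_ifs <;> simp [mul_add]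
end

section
/- For each k = 1, …, n one has Σ_{j=1}^n (∂e_k/∂x_j)(λ_1, …, λ_n) · Π_{l ≠ j} (λ_j − λ_l + 1)(λ_j − λ_l)^{−1} − e_k(λ_1, …, λ_n) = −e_k(λ_1 − 1, …, λ_n − 1). (This is the statement that the central element c_k of Diff_h(n) acts on the highest weight representation of highest weight (λ_1, …, λ_n) by scalar multiplication by −e_k evaluated at the shifted vector (λ_1 − 1, …, λ_n − 1), given that Γ_j acts on the highest weight vector by Π_{l ≠ j}(λ_j − λ_l + 1)/(λ_j − λ_l).) -/
open Finset

/-- Lemma 3.3 of Herlemont–Ogievetsky: the central element `c_k` of `Diff_h(n)` acts on the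
highest weight representation of highest weight `(λ_1, …, λ_n)` (with `λ_i − λ_j ∉ ℤ`, here
only `λ_i ≠ λ_j` is needed for the identity) by the scalar `−e_k(λ_1 − 1, …, λ_n − 1)`:
since `Γ_j` acts on the highest weight vector by `Π_{l ≠ j}(λ_j − λ_l + 1)/(λ_j − λ_l)`,
this is the identity
`Σ_j (∂e_k/∂x_j)(λ) Π_{l ≠ j}(λ_j − λ_l + 1)/(λ_j − λ_l) − e_k(λ) = −e_k(λ − 1)`. -/
theorem stmt8 {K : Type*} [Field K] [CharZero K] {n : ℕ} (hn : 1 ≤ n)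
    (l : Fin n → K) (hl : ∀ i j : Fin n, i ≠ j → l i ≠ l j) :
    ∀ k : ℕ, 1 ≤ k → k ≤ n →
      (∑ j, (∑ s ∈ (Finset.univ.erase j).powersetCard (k - 1), ∏ i ∈ s, l i) *
          ∏ t ∈ Finset.univ.erase j, ((l j - l t + 1) / (l j - l t))) -
        ∑ s ∈ Finset.univ.powersetCard k, ∏ i ∈ s, l i =
      -∑ s ∈ Finset.univ.powersetCard k, ∏ i ∈ s, (l i - 1) := by
  intro k hk hkn
  have key : (∑ j, Polynomial.C (∏ t ∈ Finset.univ.erase j, ((l j - l t + 1) / (l j - l t))) *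
      ∏ t ∈ Finset.univ.erase j, (Polynomial.X + Polynomial.C (l t))) =
      (∏ t, (Polynomial.X + Polynomial.C (l t))) -
        ∏ t, (Polynomial.X + Polynomial.C (l t - 1)) := by
    have hm : ∀ (s : Finset (Fin n)) (f : Fin n → K),
        (∏ t ∈ s, (Polynomial.X + Polynomial.C (f t))).degree = (s.card : WithBot ℕ) := by
      intro s f
      rw [Polynomial.degree_prod]
      simp
    have hmon : ∀ (s : Finset (Fin n)) (f : Fin n → K),
        (∏ t ∈ s, (Polynomial.X + Polynomial.C (f t))).Monic := fun s f =>
      Polynomial.monic_prod_of_monic _ _ fun i _ => Polynomial.monic_X_add_C _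
    refine Polynomial.eq_of_degrees_lt_of_eval_index_eq (s := Finset.univ)
      (v := fun i => - l i) ?_ ?_ ?_ ?_
    · intro i _ j _ h
      by_contra hne
      exact hl i j hne (neg_injective h)
    · refine lt_of_le_of_lt (Polynomial.degree_sum_le _ _) ?_
      rw [Finset.sup_lt_iff (by exact WithBot.bot_lt_coe _)]
      intro j _
      rw [← Polynomial.smul_eq_C_mul]
      refine lt_of_le_of_lt (Polynomial.degree_smul_le _ _) ?_
      rw [hm]
      exact_mod_cast Finset.card_erase_lt_of_mem (Finset.mem_univ j)
    · rw [← hm Finset.univ l]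
      refine Polynomial.degree_sub_lt_left (by rw [hm, hm]) (hmon _ _).ne_zero ?_
      rw [(hmon _ _).leadingCoeff, (hmon _ _).leadingCoeff]
    · intro i _
      rw [Polynomial.eval_finsetSum, Finset.sum_eq_single i]
      · simp only [Polynomial.eval_mul, Polynomial.eval_C, Polynomial.eval_prod,
          Polynomial.eval_add, Polynomial.eval_X, Polynomial.eval_sub]
        rw [Finset.prod_eq_zero (Finset.mem_univ i) (by simp),
          ← Finset.mul_prod_erase Finset.univ _ (Finset.mem_univ i), ← Finset.prod_mul_distrib]
        have : ∀ t ∈ Finset.univ.erase i, (l i - l t + 1) / (l i - l t) * (-l i + l t) =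
            -l i + (l t - 1) := by
          intro t ht
          have h : l i - l t ≠ 0 := sub_ne_zero.mpr (hl i t (Finset.ne_of_mem_erase ht).symm)
          field_simp
          ring
        rw [Finset.prod_congr rfl this]
        ring
      · intro j _ hj
        rw [Polynomial.eval_mul, Polynomial.eval_prod]
        refine mul_eq_zero_of_right _ (Finset.prod_eq_zero (i := i) (Finset.mem_erase.mpr ⟨hj.symm, Finset.mem_univ i⟩)
            (by simp))
      · simp
  have h := congrArg (fun p => Polynomial.coeff p (n - k)) key
  simp only [Polynomial.finsetSum_coeff, Polynomial.coeff_C_mul, Polynomial.coeff_sub] at h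
  have c1 : ∀ f : Fin n → K, (∏ t, (Polynomial.X + Polynomial.C (f t))).coeff (n - k) =
      ∑ s ∈ Finset.univ.powersetCard k, ∏ i ∈ s, f i := by
    intro f
    rw [Finset.prod_X_add_C_coeff _ _ (by simp)]
    simp [Nat.sub_sub_self hkn]
  have c2 : ∀ j : Fin n, (∏ t ∈ Finset.univ.erase j,
      (Polynomial.X + Polynomial.C (l t))).coeff (n - k) =
      ∑ s ∈ (Finset.univ.erase j).powersetCard (k - 1), ∏ i ∈ s, l i := by
    intro j
    have hc : (Finset.univ.erase j).card = n - 1 := by simp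
    rw [Finset.prod_X_add_C_coeff _ _ (by omega), hc,
      show n - 1 - (n - k) = k - 1 by omega]
  simp only [c1, c2] at h
  rw [Finset.sum_congr rfl fun j _ => mul_comm _ _, h]
  ring
end

section
/- Set h̃_i = ℋ_i, Z^i = X^i (Ψ'_i)^{−1}, and ∂_i = Υ_i Ψ_i^{−1} (X^i)^{−1}. Then these elements satisfy the defining relations of the ring Diff_h(n) of h-deformed differential operators of type A: the h̃_i pairwise commute; h̃_i Z^j = Z^j (h̃_i + δ_{ij}) and h̃_i ∂_j = ∂_j (h̃_i − δ_{ij}) for all i, j; Z^i Z^j = (h̃_{ij} + 1) h̃_{ij}^{−1} Z^j Z^i for i < j; ∂_i ∂_j = (h̃_{ij} − 1) h̃_{ij}^{−1} ∂_j ∂_i for i < j; Z^i ∂_j = ∂_j Z^i for i < j; Z^i ∂_j = h̃_{ij}(h̃_{ij} − 2)(h̃_{ij} − 1)^{−2} ∂_j Z^i for i > j; and Z^i ∂_i = Σ_{j=1}^n (1 − h̃_{ij})^{−1} ∂_j Z^j − 1 for each i, where h̃_{ij} = h̃_i − h̃_j. (This expresses that the map μ^{−1} from the localized ring of h-deformed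 differential operators to the localized Weyl algebra extended by n indeterminates respects the defining relations.) -/
open Finset

theorem aux_v {C : Type*} [CommRing C] {n : ℕ} (h : Fin n → C) (v : Fin n → Fin n → ℤ → C)
    (hv : ∀ (i j : Fin n) (m : ℤ), i ≠ j → (h i - h j + (m : C)) * v i j m = 1) (φ : C →+* C) (d : Fin n → ℤ)
    (hφ : ∀ j, φ (h j) = h j + (d j : C)) (i j : Fin n) (m m' : ℤ) (hij : i ≠ j)
    (hm : m' = m + d i - d j) : φ (v i j m) = v i j m' := by
  have h1 := congrArg φ (hv i j m hij)
  have h2 := hv i j m' hij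
  simp only [map_mul, map_add, map_sub, map_one, map_intCast, hφ] at h1
  subst hm
  push_cast at h2
  linear_combination (-(φ (v i j m))) * h2 + (v i j (m + d i - d j)) * h1

open Polynomial in
theorem aux_lagrange {C : Type*} [CommRing C] {n : ℕ} (h : Fin n → C)
    (w : Fin n → Fin n → C)
    (hw : ∀ i j, i ≠ j → (h i - h j) * w i j = 1) (f : Polynomial C) (hf : f.Monic)
    (hd : f.natDegree = n) (t : C) :
    f.eval t = ∏ m, (t - h m) +
      ∑ j, f.eval (h j) * ∏ m ∈ univ.erase j, (w j m * (t - h m)) := by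
  classical
  rcases subsingleton_or_nontrivial C with hC | hC
  · exact Subsingleton.elim _ _
  let M : C[X] := ∏ m, (Polynomial.X - Polynomial.C (h m))
  let L : Fin n → C[X] := fun j => ∏ m ∈ univ.erase j,
    (Polynomial.C (w j m) * (Polynomial.X - Polynomial.C (h m)))
  let g : C[X] := f - M - ∑ j, Polynomial.C (f.eval (h j)) * L j
  have hM : M.Monic := monic_prod_of_monic _ _ (fun m _ => monic_X_sub_C _)
  have hMd : M.natDegree = n := by
    simp only [M]
    rw [natDegree_prod_of_monic _ _ (fun m _ => monic_X_sub_C _)]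
    simp
  have hMdeg : M.degree = n := by rw [degree_eq_natDegree hM.ne_zero, hMd]
  have hfdeg : f.degree = n := by rw [degree_eq_natDegree hf.ne_zero, hd]
  have hgd : g.degree < M.degree := by
    refine (degree_sub_le _ _).trans_lt (max_lt ?_ ?_)
    · rw [hMdeg, ← hfdeg]
      exact degree_sub_lt_left (by rw [hMdeg, hfdeg]) hf.ne_zero (by rw [hf.leadingCoeff, hM.leadingCoeff])
    · rw [hMdeg]
      refine (degree_sum_le _ _).trans_lt ?_
      rw [Finset.sup_lt_iff (by exact WithBot.bot_lt_coe _)]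
      intro j _
      have hn : 0 < n := j.pos
      have : (Polynomial.C (f.eval (h j)) * L j).natDegree ≤ n - 1 := by
        refine (natDegree_C_mul_le _ _).trans ?_
        refine (natDegree_prod_le _ _).trans ?_
        refine (Finset.sum_le_card_nsmul _ _ 1 ?_).trans ?_
        · intro m _
          refine (natDegree_C_mul_le _ _).trans ?_
          simp
        · simp
      refine degree_le_natDegree.trans_lt ?_
      have h3 : (Polynomial.C (f.eval (h j)) * L j).natDegree < n := by omega
      exact_mod_cast h3
  have hroot : ∀ i, g.eval (h i) = 0 := by
    intro i
    simp only [g, M, L, eval_sub, eval_finsetSum, eval_mul, eval_prod, eval_C, eval_X]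
    rw [Finset.prod_eq_zero (mem_univ i) (by simp), Finset.sum_eq_single i]
    · rw [Finset.prod_eq_one]
      · ring
      · intro m hm
        rw [mul_comm]
        exact hw i m (Finset.ne_of_mem_erase hm).symm
    · intro j _ hj
      rw [Finset.prod_eq_zero (i := i), mul_zero]
      · simp [hj.symm]
      · simp
    · simp
  have hdvd : M ∣ g := by
    refine Finset.prod_dvd_of_coprime ?_ ?_
    · intro i _ j _ hij
      exact isCoprime_X_sub_C_of_isUnit_sub (IsUnit.of_mul_eq_one _ (hw i j hij))
    · intro i _
      exact dvd_iff_isRoot.2 (hroot i)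
  have hg : g = 0 := by
    by_contra h0
    exact hM.not_dvd_of_degree_lt h0 hgd hdvd
  have h4 := congrArg (Polynomial.eval t) hg
  simp only [g, M, L, eval_sub, eval_finsetSum, eval_mul, eval_prod, eval_C, eval_X,
    eval_zero] at h4
  linear_combination h4

universe u

theorem aux_exC {B : Type u} [Ring B] {n : ℕ} (x y h a : Fin n → B)
    (hxy : ∀ i, x i * y i = 1) (hyx : ∀ i, y i * x i = 1)
    (hh : ∀ i j, h i * h j = h j * h i)
    (hx : ∀ i j, h j * x i = x i * (h j + if i = j then 1 else 0))
    (ha : ∀ i b, a i * b = b * a i)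
    (hu : ∀ (i j : Fin n) (m : ℤ), i ≠ j → IsUnit (h i - h j + (m : B))) :
    ∃ (C : Type u) (_ : CommRing C) (ι : C →+* B) (τ σ : Fin n → C →+* C)
      (h' a' : Fin n → C) (v : Fin n → Fin n → ℤ → C),
      Function.Injective ι ∧ (∀ i, ι (h' i) = h i) ∧ (∀ i, ι (a' i) = a i) ∧
      (∀ i c, x i * ι c = ι (τ i c) * x i) ∧ (∀ i c, y i * ι c = ι (σ i c) * y i) ∧
      (∀ (i j : Fin n) (m : ℤ), i ≠ j → (h' i - h' j + (m : C)) * v i j m = 1) := by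
  let S : Set B := Set.range h ∪ Set.range a
  let C : Subring B := Subring.centralizer (Subring.centralizer S : Set B)
  have memS' : ∀ z, z ∈ Subring.centralizer S ↔ ∀ i, h i * z = z * h i := by
    intro z
    rw [Subring.mem_centralizer_iff]
    constructor
    · intro H i
      exact H _ (Or.inl ⟨i, rfl⟩)
    · rintro H _ (⟨i, rfl⟩ | ⟨i, rfl⟩)
      · exact H i
      · exact ha i z
  have memC : ∀ c, c ∈ C ↔ ∀ z, (∀ i, h i * z = z * h i) → z * c = c * z := by
    intro c
    rw [Subring.mem_centralizer_iff]
    exact ⟨fun H z hz => H z ((memS' z).2 hz), fun H z hz => H z ((memS' z).1 hz)⟩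
  have hC : ∀ i, h i ∈ C := fun i => (memC _).2 fun z hz => (hz i).symm
  have aC : ∀ i, a i ∈ C := fun i => (memC _).2 fun z hz => (ha i z).symm
  have comm : ∀ c ∈ C, ∀ d ∈ C, c * d = d * c := by
    intro c hc d hd
    exact (memC d).1 hd c fun i => (memC c).1 hc (h i) fun j => hh j i
  let inst : CommRing C :=
    { (inferInstance : Ring C) with
      mul_comm := fun c d => Subtype.ext (comm c c.2 d d.2) }
  have hxh : ∀ i j, x i * h j = (h j - if i = j then 1 else 0) * x i := by
    intro i j
    rw [sub_mul, hx]
    split_ifs <;> noncomm_ring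
  have hyh : ∀ i j, y i * h j = (h j + if i = j then 1 else 0) * y i := by
    intro i j
    have := congrArg (fun b => y i * b * y i) (hx i j)
    simp only [← mul_assoc, hyx, one_mul] at this
    rw [mul_assoc, hxy, mul_one] at this
    exact this
  have hhy : ∀ i j, h j * y i = y i * (h j - if i = j then 1 else 0) := by
    intro i j
    rw [mul_sub, hyh]
    split_ifs <;> noncomm_ring
  have key1 : ∀ i c, c ∈ C → x i * c * y i ∈ C := by
    intro i c hc
    rw [memC]
    intro z hz
    have h1 := (memC c).1 hc (y i * z * x i) (by
      intro j
      rw [← mul_assoc, ← mul_assoc, hhy, mul_assoc (y i * z) , mul_assoc (y i), hxh]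
      have : (h j - if i = j then 1 else 0) * z = z * (h j - if i = j then 1 else 0) := by
        rw [sub_mul, mul_sub, hz]; split_ifs <;> simp
      rw [this, mul_assoc (y i), mul_assoc z, mul_assoc])
    calc z * (x i * c * y i) = (x i * y i) * z * (x i * c * y i) := by rw [hxy, one_mul]
      _ = x i * (y i * z * x i * c) * y i := by noncomm_ring
      _ = x i * (c * (y i * z * x i)) * y i := by rw [h1]
      _ = x i * c * y i * z * (x i * y i) := by noncomm_ring
      _ = _ := by rw [hxy, mul_one]
  have key2 : ∀ i c, c ∈ C → y i * c * x i ∈ C := by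
    intro i c hc
    rw [memC]
    intro z hz
    have h1 := (memC c).1 hc (x i * z * y i) (by
      intro j
      rw [← mul_assoc, ← mul_assoc, hx, mul_assoc (x i * z) , mul_assoc (x i), hyh]
      have : (h j + if i = j then 1 else 0) * z = z * (h j + if i = j then 1 else 0) := by
        rw [add_mul, mul_add, hz]; split_ifs <;> simp
      rw [this, mul_assoc (x i), mul_assoc z, mul_assoc])
    calc z * (y i * c * x i) = (y i * x i) * z * (y i * c * x i) := by rw [hyx, one_mul]
      _ = y i * (x i * z * y i * c) * x i := by noncomm_ring
      _ = y i * (c * (x i * z * y i)) * x i := by rw [h1]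
      _ = y i * c * x i * z * (y i * x i) := by noncomm_ring
      _ = _ := by rw [hyx, mul_one]
  let ι : C →+* B := 
    { toFun := fun c => c.1, map_one' := rfl, map_mul' := fun _ _ => rfl, map_zero' := rfl,
      map_add' := fun _ _ => rfl }
  let τ : Fin n → C →+* C := fun i =>
    { toFun := fun c => ⟨x i * c.1 * y i, key1 i c.1 c.2⟩
      map_one' := Subtype.ext (by change x i * 1 * y i = 1; rw [mul_one, hxy])
      map_zero' := Subtype.ext (by change x i * 0 * y i = 0; simp)
      map_add' := fun c d => Subtype.ext (by
        change x i * (c.1 + d.1) * y i = x i * c.1 * y i + x i * d.1 * y i; noncomm_ring)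
      map_mul' := fun c d => Subtype.ext (by
        change x i * (c.1 * d.1) * y i = (x i * c.1 * y i) * (x i * d.1 * y i)
        calc _ = x i * c.1 * 1 * d.1 * y i := by noncomm_ring
          _ = _ := by rw [← hyx i]; noncomm_ring) }
  let σ : Fin n → C →+* C := fun i =>
    { toFun := fun c => ⟨y i * c.1 * x i, key2 i c.1 c.2⟩
      map_one' := Subtype.ext (by change y i * 1 * x i = 1; rw [mul_one, hyx])
      map_zero' := Subtype.ext (by change y i * 0 * x i = 0; simp)
      map_add' := fun c d => Subtype.ext (by
        change y i * (c.1 + d.1) * x i = y i * c.1 * x i + y i * d.1 * x i; noncomm_ring)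
      map_mul' := fun c d => Subtype.ext (by
        change y i * (c.1 * d.1) * x i = (y i * c.1 * x i) * (y i * d.1 * x i)
        calc _ = y i * c.1 * 1 * d.1 * x i := by noncomm_ring
          _ = _ := by rw [← hxy i]; noncomm_ring) }
  let h' : Fin n → C := fun i => ⟨h i, hC i⟩
  let a' : Fin n → C := fun i => ⟨a i, aC i⟩
  have hι : Function.Injective ι := fun c d hcd => Subtype.ext hcd
  have exv : ∀ i j (m : ℤ), ∃ w : C, i ≠ j → (h' i - h' j + (m : C)) * w = 1 := by
    intro i j m
    by_cases hij : i = j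
    · exact ⟨0, fun H => absurd hij H⟩
    obtain ⟨u, hu'⟩ := hu i j m hij
    have huC : (u : B) ∈ C := by
      have h5 : (u : B) = ι (h' i - h' j + (m : C)) := by
        rw [hu']; simp only [map_add, map_sub, map_intCast]; rfl
      rw [h5]; exact (h' i - h' j + (m : C)).2
    have huiC : (↑u⁻¹ : B) ∈ C := by
      rw [memC] at huC ⊢
      intro z hz
      exact ((show Commute z u from huC z hz).units_inv_right).eq
    refine ⟨⟨_, huiC⟩, fun _ => hι ?_⟩
    rw [map_mul, map_one]
    simp only [map_add, map_sub, map_intCast]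
    change (h i - h j + (m : B)) * (↑u⁻¹ : B) = 1
    rw [← hu']
    exact u.mul_inv
  choose v hv using exv
  refine ⟨↥C, inst, ι, τ, σ, h', a', v, hι, fun _ => rfl, fun _ => rfl, ?_, ?_, hv⟩
  · intro i c
    change x i * c.1 = x i * c.1 * y i * x i
    rw [mul_assoc _ (y i), hyx, mul_one]
  · intro i c
    change y i * c.1 = y i * c.1 * x i * y i
    rw [mul_assoc _ (x i), hxy, mul_one]

theorem aux_oprod {B C : Type*} [Ring B] [CommRing C] (ι : C →+* B) {n : ℕ} (s : Finset (Fin n))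
    (f : Fin n → C) (g : Fin n → B) (hg : ∀ m ∈ s, g m = ι (f m)) :
    oprod s g = ι (∏ m ∈ s, f m) := by
  unfold oprod
  rw [Finset.prod_eq_multiset_prod, ← Finset.sort_eq s (· ≤ ·), Multiset.map_coe,
    Multiset.prod_coe, map_list_prod, List.map_map]
  congr 1
  apply List.map_congr_left
  intro m hm
  exact hg m (by simpa using hm)

theorem aux_inv_s9 {B C : Type*} [Ring B] [CommRing C] (ι : C →+* B) (c d : C) (b : B)
    (hb : b = ι c) (hcd : c * d = 1) : Ring.inverse b = ι d := by
  have h1 : b * ι d = 1 := by rw [hb, ← map_mul, hcd, map_one]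
  have h2 : ι d * b = 1 := by rw [hb, ← map_mul, mul_comm, hcd, map_one]
  exact Ring.inverse_unit (⟨b, ι d, h1, h2⟩ : Bˣ)

theorem aux_prod_fix {C : Type*} [CommRing C] {n : ℕ} (φ : C →+* C) (s : Finset (Fin n))
    (f g : Fin n → C) (H : ∀ m ∈ s, φ (f m) = g m) : φ (∏ m ∈ s, f m) = ∏ m ∈ s, g m := by
  rw [map_prod]
  exact Finset.prod_congr rfl H

/-- the facts in the commutative ring -/
theorem aux_core {C : Type*} [CommRing C] {n : ℕ} (h a : Fin n → C) (v : Fin n → Fin n → ℤ → C)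
    (hv : ∀ (i j : Fin n) (m : ℤ), i ≠ j → (h i - h j + (m : C)) * v i j m = 1)
    (τ σ : Fin n → C →+* C)
    (τh : ∀ i j, τ i (h j) = h j - if i = j then 1 else 0)
    (σh : ∀ i j, σ i (h j) = h j + if i = j then 1 else 0)
    (τa : ∀ i j, τ i (a j) = a j) (σa : ∀ i j, σ i (a j) = a j)
    (U P Q R : Fin n → C)
    (hU : ∀ i, U i = h i ^ n + ∑ K : Fin n, (-1 : C) ^ (K : ℕ) * a K * h i ^ (n - 1 - (K : ℕ)))
    (hP : ∀ i, P i = τ i (∏ m ∈ univ.filter (fun m => m < i), v i m 0))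
    (hQ : ∀ i, Q i = ∏ m ∈ univ.filter (fun m => i < m), v i m 0)
    (hR : ∀ i, R i = U i * Q i) :
    (∀ i j, i < j → P i * τ i (P j) = (h i - h j + 1) * v i j 0 * (P j * τ j (P i))) ∧
    (∀ i j, i < j → R i * σ i (R j) = (h i - h j - 1) * v i j 0 * (R j * σ j (R i))) ∧
    (∀ i j, i < j → P i * τ i (R j) = R j * σ j (P i)) ∧
    (∀ i j, j < i → P i * τ i (R j) =
      (h i - h j) * (h i - h j - 2) * (v i j (-1)) ^ 2 * (R j * σ j (P i))) ∧
    (∀ i, P i * τ i (R i) =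
      (∑ j, (if i = j then 1 else v j i 1) * (R j * σ j (P j))) - 1) := by
  classical
  have τv : ∀ l i j (m m' : ℤ), i ≠ j →
      m' = m - (if l = i then 1 else 0) + (if l = j then 1 else 0) →
      τ l (v i j m) = v i j m' := by
    intro l i j m m' hij hm
    refine aux_v h v hv (τ l) (fun j => - if l = j then 1 else 0) ?_ i j m m' hij ?_
    · intro j; rw [τh]; split_ifs <;> simp [sub_eq_add_neg]
    · rw [hm]; ring
  have σv : ∀ l i j (m m' : ℤ), i ≠ j →
      m' = m + (if l = i then 1 else 0) - (if l = j then 1 else 0) →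
      σ l (v i j m) = v i j m' := by
    intro l i j m m' hij hm
    refine aux_v h v hv (σ l) (fun j => if l = j then 1 else 0) ?_ i j m m' hij ?_
    · intro j; rw [σh]; split_ifs <;> simp
    · rw [hm]
  have hP' : ∀ i, P i = ∏ m ∈ univ.filter (fun m => m < i), v i m (-1) := by
    intro i
    rw [hP]
    refine aux_prod_fix _ _ _ _ fun m hm => ?_
    have hm : m < i := by simpa using hm
    exact τv _ _ _ _ _ hm.ne' (by simp [hm.ne'])
  have τU : ∀ i j, i ≠ j → τ i (U j) = U j := by
    intro i j hij
    rw [hU]; simp [τh, τa, hij]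
  have σU : ∀ i j, i ≠ j → σ i (U j) = U j := by
    intro i j hij
    rw [hU]; simp [σh, σa, hij]
  -- trivial actions
  have τP : ∀ i j, i < j → τ j (P i) = P i := by
    intro i j hij
    rw [hP']
    refine aux_prod_fix _ _ _ _ fun m hm => ?_
    have hm : m < i := by simpa using hm
    exact τv _ _ _ _ _ hm.ne' (by simp [hij.ne', (hm.trans hij).ne'])
  have σP : ∀ i j, i < j → σ j (P i) = P i := by
    intro i j hij
    rw [hP']
    refine aux_prod_fix _ _ _ _ fun m hm => ?_
    have hm : m < i := by simpa using hm
    exact σv _ _ _ _ _ hm.ne' (by simp [hij.ne', (hm.trans hij).ne'])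
  have τR : ∀ i j, i < j → τ i (R j) = R j := by
    intro i j hij
    rw [hR, map_mul, τU _ _ hij.ne, hQ]
    congr 1
    refine aux_prod_fix _ _ _ _ fun m hm => ?_
    have hm : j < m := by simpa using hm
    exact τv _ _ _ _ _ hm.ne (by simp [hij.ne, (hij.trans hm).ne])
  have σR : ∀ i j, i < j → σ i (R j) = R j := by
    intro i j hij
    rw [hR, map_mul, σU _ _ hij.ne, hQ]
    congr 1
    refine aux_prod_fix _ _ _ _ fun m hm => ?_
    have hm : j < m := by simpa using hm
    exact σv _ _ _ _ _ hm.ne (by simp [hij.ne, (hij.trans hm).ne])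
  -- splitting
  have splitP : ∀ i j, j < i → ∃ r, P i = v i j (-1) * r ∧ τ j (P i) = v i j 0 * r ∧
      σ j (P i) = v i j (-2) * r := by
    intro i j hij
    have e : P i = v i j (-1) * ∏ m ∈ (univ.filter (fun m => m < i)).erase j, v i m (-1) := by
      rw [hP', Finset.mul_prod_erase _ (fun m => v i m (-1)) (by simpa using hij)]
    refine ⟨_, e, ?_, ?_⟩
    · rw [e, map_mul, τv j i j (-1) 0 hij.ne' (by simp [hij.ne])]
      congr 1
      refine aux_prod_fix _ _ _ _ fun m hm => ?_
      simp only [mem_erase, mem_filter, mem_univ, true_and] at hm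
      exact τv _ _ _ _ _ hm.2.ne' (by simp [hij.ne, hm.1.symm])
    · rw [e, map_mul, σv j i j (-1) (-2) hij.ne' (by simp [hij.ne])]
      congr 1
      refine aux_prod_fix _ _ _ _ fun m hm => ?_
      simp only [mem_erase, mem_filter, mem_univ, true_and] at hm
      exact σv _ _ _ _ _ hm.2.ne' (by simp [hij.ne, hm.1.symm])
  have splitR : ∀ i j, i < j → ∃ r, R i = v i j 0 * r ∧ τ j (R i) = v i j 1 * r ∧
      σ j (R i) = v i j (-1) * r := by
    intro i j hij
    have e : R i = v i j 0 *
        (U i * ∏ m ∈ (univ.filter (fun m => i < m)).erase j, v i m 0) := by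
      rw [hR, hQ, ← Finset.mul_prod_erase _ (fun m => v i m 0) (a := j) (by simpa using hij)]
      ring
    refine ⟨_, e, ?_, ?_⟩
    · rw [e, map_mul, map_mul, τU _ _ hij.ne', τv j i j 0 1 hij.ne (by simp [hij.ne'])]
      congr 2
      refine aux_prod_fix _ _ _ _ fun m hm => ?_
      simp only [mem_erase, mem_filter, mem_univ, true_and] at hm
      exact τv _ _ _ _ _ hm.2.ne (by simp [hij.ne', hm.1.symm])
    · rw [e, map_mul, map_mul, σU _ _ hij.ne', σv j i j 0 (-1) hij.ne (by simp [hij.ne'])]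
      congr 2
      refine aux_prod_fix _ _ _ _ fun m hm => ?_
      simp only [mem_erase, mem_filter, mem_univ, true_and] at hm
      exact σv _ _ _ _ _ hm.2.ne (by simp [hij.ne', hm.1.symm])
  have vneg : ∀ i j m m', i ≠ j → m' = -m → v j i m' = - v i j m := by
    intro i j m m' hij hm
    have h1 := hv i j m hij
    have h2 := hv j i m' hij.symm
    subst hm
    push_cast at h2
    linear_combination (-(v j i (-m))) * h1 - (v i j m) * h2
  refine ⟨?_, ?_, ?_, ?_, ?_⟩
  · intro i j hij
    obtain ⟨r, h1, h2, -⟩ := splitP j i hij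
    rw [h2, τP i j hij, h1, vneg i j 0 0 hij.ne (by simp), vneg i j 1 (-1) hij.ne (by simp)]
    have := hv i j 1 hij.ne
    push_cast at this
    linear_combination (v i j 0 * r * P i) * this
  · intro i j hij
    obtain ⟨r, h1, -, h2⟩ := splitR i j hij
    rw [h2, σR i j hij, h1]
    have := hv i j (-1) hij.ne
    push_cast at this
    linear_combination (-v i j 0 * r * R j) * this
  · intro i j hij
    rw [τR _ _ hij, σP _ _ hij, mul_comm]
  · intro i j hij
    obtain ⟨r, h1, -, h2⟩ := splitP i j hij
    obtain ⟨s, h3, h4, -⟩ := splitR j i hij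
    rw [h2, h1, h4, h3, vneg i j 0 0 hij.ne' (by simp), vneg i j (-1) 1 hij.ne' (by simp)]
    have e1 := hv i j 0 hij.ne'
    have e2 := hv i j (-2) hij.ne'
    push_cast at e1 e2
    linear_combination (v i j (-1)^2 * r * s) * ((h i - h j - 2) * v i j (-2) * e1 + e2)
  · intro i
    have hn : 0 < n := i.pos
    let f : Polynomial C := Polynomial.X ^ n + ∑ K : Fin n,
      Polynomial.C ((-1 : C) ^ (K : ℕ) * a K) * Polynomial.X ^ (n - 1 - (K : ℕ))
    have hlt : (∑ K : Fin n,
        Polynomial.C ((-1 : C) ^ (K : ℕ) * a K) * Polynomial.X ^ (n - 1 - (K : ℕ))).degree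
        < (n : WithBot ℕ) := by
      refine (Polynomial.degree_sum_le _ _).trans_lt ?_
      rw [Finset.sup_lt_iff (by exact WithBot.bot_lt_coe _)]
      intro K _
      refine (Polynomial.degree_C_mul_X_pow_le _ _).trans_lt ?_
      have : n - 1 - (K : ℕ) < n := by omega
      exact_mod_cast this
    rcases subsingleton_or_nontrivial C with hC | hC
    · exact Subsingleton.elim _ _
    have hfm : f.Monic := Polynomial.monic_X_pow_add hlt
    have hfd : f.natDegree = n := by
      apply Polynomial.natDegree_eq_of_degree_eq_some
      rw [Polynomial.degree_add_eq_left_of_degree_lt, Polynomial.degree_X_pow]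
      rwa [Polynomial.degree_X_pow]
    have hfe : ∀ t, f.eval t =
        t ^ n + ∑ K : Fin n, (-1 : C) ^ (K : ℕ) * a K * t ^ (n - 1 - (K : ℕ)) := by
      intro t
      simp [f, Polynomial.eval_finsetSum]
    have hfU : ∀ j, f.eval (h j) = U j := fun j => by rw [hfe, hU]
    have L := aux_lagrange h (fun i j => v i j 0) (fun i j hij => by
      have := hv i j 0 hij
      simpa using this) f hfm hfd (h i - 1)
    have hcover : ∀ (j : Fin n) (g : Fin n → C), (∏ m ∈ univ.filter (fun m => m < j), g m) *
        (∏ m ∈ univ.filter (fun m => j < m), g m) = ∏ m ∈ univ.erase j, g m := by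
      intro j g
      rw [← Finset.prod_union]
      · congr 1
        ext m
        simp [lt_or_lt_iff_ne]
      · rw [Finset.disjoint_left]
        intro m hm hm'
        simp only [mem_filter, mem_univ, true_and] at hm hm'
        exact absurd hm (not_lt.2 hm'.le)
    have hL : P i * τ i (R i) = f.eval (h i - 1) * ∏ m ∈ univ.erase i, v i m (-1) := by
      have e1 : τ i (U i) = f.eval (h i - 1) := by
        rw [hU, hfe]; simp [τh, τa]
      have e2 : τ i (Q i) = ∏ m ∈ univ.filter (fun m => i < m), v i m (-1) := by
        rw [hQ]
        refine aux_prod_fix _ _ _ _ fun m hm => ?_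
        have hm : i < m := by simpa using hm
        exact τv _ _ _ _ _ hm.ne (by simp [hm.ne])
      rw [hR, map_mul, e1, e2, hP', ← hcover]
      ring
    have hRj : ∀ j, R j * σ j (P j) = U j * ∏ m ∈ univ.erase j, v j m 0 := by
      intro j
      have e2 : σ j (P j) = ∏ m ∈ univ.filter (fun m => m < j), v j m 0 := by
        rw [hP']
        refine aux_prod_fix _ _ _ _ fun m hm => ?_
        have hm : m < j := by simpa using hm
        exact σv _ _ _ _ _ hm.ne' (by simp [hm.ne'])
      rw [hR, e2, hQ, ← hcover]
      ring
    have hone : (∏ m ∈ univ.erase i, (h i - 1 - h m)) * ∏ m ∈ univ.erase i, v i m (-1) = 1 := by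
      rw [← Finset.prod_mul_distrib]
      refine Finset.prod_eq_one fun m hm => ?_
      have := hv i m (-1) (Finset.ne_of_mem_erase hm).symm
      push_cast at this
      linear_combination this
    have hall : (∏ m, (h i - 1 - h m)) = - ∏ m ∈ univ.erase i, (h i - 1 - h m) := by
      rw [← Finset.mul_prod_erase univ _ (mem_univ i)]
      ring
    rw [hL, L, add_mul, hall, Finset.sum_mul, neg_mul, hone, neg_add_eq_sub]
    congr 1
    refine Finset.sum_congr rfl fun j _ => ?_
    rw [hRj, hfU, Finset.prod_mul_distrib]
    by_cases hij : i = j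
    · subst hij
      rw [if_pos rfl]
      linear_combination (U i * ∏ m ∈ univ.erase i, v i m 0) * hone
    · rw [if_neg hij]
      have e3 : (h i - 1 - h j) * (∏ m ∈ univ.erase j, (h i - 1 - h m)) =
          - ∏ m ∈ univ.erase i, (h i - 1 - h m) := by
        rw [← hall, Finset.mul_prod_erase univ (fun m => h i - 1 - h m) (mem_univ j)]
      have e4 := hv j i 1 (Ne.symm hij)
      push_cast at e4
      linear_combination (U j * ∏ m ∈ univ.erase j, v j m 0) * ((v j i 1) * hone
        - (∏ m ∈ univ.erase i, v i m (-1)) * v j i 1 * e3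
        - (∏ m ∈ univ.erase i, v i m (-1)) * (∏ m ∈ univ.erase j, (h i - 1 - h m)) * e4)

/-- The map `μ⁻¹` of Herlemont–Ogievetsky (formula (18)) respects the defining relations of
`Diff_h(n)`: in the localized Weyl algebra extended by central elements `a_1, …, a_n`, the
elements `h̃_i = ℋ_i = D_i X^i`, `Z^i = X^i (Ψ'_i)⁻¹`, `∂_i = Υ_i Ψ_i⁻¹ (X^i)⁻¹` (with
`Υ_i = ℋ_i^n + Σ_k (−1)^{k−1} a_k ℋ_i^{n−k}`) satisfy all the defining relations of the ring
of h-deformed differential operators of type A. -/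
theorem stmt9 {k B : Type*} [Field k] [CharZero k] [Ring B] [Algebra k B]
    {n : ℕ} (hn : 1 ≤ n) (X D a : Fin n → B)
    (hXX : ∀ i j, X i * X j = X j * X i)
    (hDD : ∀ i j, D i * D j = D j * D i)
    (hDX : ∀ i j, D i * X j - X j * D i = if i = j then (1 : B) else 0)
    (hXunit : ∀ i, IsUnit (X i))
    (hHunit : ∀ (i j : Fin n) (m : ℤ), i ≠ j → IsUnit (D i * X i - (D j * X j) + (m : B)))
    (hacen : ∀ (i : Fin n) (b : B), a i * b = b * a i) :
    ∀ hw Zd Dd : Fin n → B,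
      hw = (fun i => D i * X i) →
      Zd = (fun i => X i * Ring.inverse
            (oprod (Finset.univ.filter fun m => m < i) (fun m => hw i - hw m))) →
      Dd = (fun i => (hw i ^ n + ∑ K : Fin n, (-1 : B) ^ (K : ℕ) * a K * hw i ^ (n - 1 - (K : ℕ))) *
            Ring.inverse (oprod (Finset.univ.filter fun m => i < m) (fun m => hw i - hw m)) *
            Ring.inverse (X i)) →
      ((∀ i j, hw i * hw j = hw j * hw i) ∧
      (∀ i j, hw i * Zd j = Zd j * (hw i + if i = j then 1 else 0)) ∧
      (∀ i j, hw i * Dd j = Dd j * (hw i - if i = j then 1 else 0)) ∧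
      (∀ i j, i < j → Zd i * Zd j =
        (hw i - hw j + 1) * Ring.inverse (hw i - hw j) * (Zd j * Zd i)) ∧
      (∀ i j, i < j → Dd i * Dd j =
        (hw i - hw j - 1) * Ring.inverse (hw i - hw j) * (Dd j * Dd i)) ∧
      (∀ i j, i < j → Zd i * Dd j = Dd j * Zd i) ∧
      (∀ i j, j < i → Zd i * Dd j =
        (hw i - hw j) * (hw i - hw j - 2) * (Ring.inverse (hw i - hw j - 1)) ^ 2 * (Dd j * Zd i)) ∧
      (∀ i, Zd i * Dd i = (∑ j, Ring.inverse (1 - (hw i - hw j)) * (Dd j * Zd j)) - 1)) := by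
  intro hw Zd Dd hhw hZ hD
  have hx0 : ∀ i j, hw j * X i = X i * (hw j + if i = j then 1 else 0) := by
    intro i j
    have h1 := hDX j i
    rw [hhw]
    simp only
    have h2 : D j * X i = X i * D j + if j = i then 1 else 0 := by rw [← h1]; abel
    rw [mul_assoc, hXX j i, ← mul_assoc, h2]
    by_cases hij : i = j
    · subst hij; simp only [if_true]; noncomm_ring
    · simp only [if_neg hij, if_neg (Ne.symm hij)]; noncomm_ring
  have hhc : ∀ i j, hw i * hw j = hw j * hw i := by
    intro i j
    by_cases hij : i = j
    · rw [hij]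
    have h1 : hw i * X j = X j * hw i := by
      rw [hx0, if_neg (Ne.symm hij), add_zero]
    have h2 : hw i * D j = D j * hw i := by
      have h3 := hDX j i
      rw [if_neg (Ne.symm hij), sub_eq_zero] at h3
      rw [hhw]
      simp only
      rw [mul_assoc, ← h3, ← mul_assoc, hDD, mul_assoc]
    calc hw i * hw j = hw i * D j * X j := by rw [hhw]; simp only [mul_assoc]
      _ = D j * (hw i * X j) := by rw [h2, mul_assoc]
      _ = D j * X j * hw i := by rw [h1, mul_assoc]
      _ = hw j * hw i := by rw [hhw]
  let Y : Fin n → B := fun i => Ring.inverse (X i)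
  have hXY : ∀ i, X i * Y i = 1 := fun i => Ring.mul_inverse_cancel _ (hXunit i)
  have hYX : ∀ i, Y i * X i = 1 := fun i => Ring.inverse_mul_cancel _ (hXunit i)
  have hYXc : ∀ i j, Y i * X j = X j * Y i := by
    intro i j
    calc Y i * X j = Y i * X j * (X i * Y i) := by rw [hXY, mul_one]
      _ = Y i * (X j * X i) * Y i := by noncomm_ring
      _ = Y i * X i * X j * Y i := by rw [hXX]; noncomm_ring
      _ = _ := by rw [hYX, one_mul]
  have hYY : ∀ i j, Y i * Y j = Y j * Y i := by
    intro i j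
    calc Y i * Y j = Y i * Y j * (X i * Y i) := by rw [hXY, mul_one]
      _ = Y i * (Y j * X i) * Y i := by noncomm_ring
      _ = Y i * X i * Y j * Y i := by rw [hYXc]; noncomm_ring
      _ = _ := by rw [hYX, one_mul]
  obtain ⟨C, _, ι, τ, σ, h, a', v, hι, ιh, ιa, ιx, ιy, hv⟩ := aux_exC X Y hw a hXY hYX hhc hx0
    hacen (by rw [hhw]; exact hHunit)
  have τeq : ∀ i c d, X i * ι c = ι d * X i → τ i c = d := by
    intro i c d hcd
    apply hι
    have h1 := (ιx i c).symm.trans hcd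
    have h2 := congrArg (fun b => b * Y i) h1
    simpa [mul_assoc, hXY] using h2
  have σeq : ∀ i c d, Y i * ι c = ι d * Y i → σ i c = d := by
    intro i c d hcd
    apply hι
    have h1 := (ιy i c).symm.trans hcd
    have h2 := congrArg (fun b => b * X i) h1
    simpa [mul_assoc, hYX] using h2
  have τh : ∀ i j, τ i (h j) = h j - if i = j then 1 else 0 := by
    intro i j
    apply τeq
    have h1 := hx0 i j
    rw [map_sub, ιh, sub_mul, h1]
    split_ifs <;> simp [mul_add]
  have σh : ∀ i j, σ i (h j) = h j + if i = j then 1 else 0 := by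
    intro i j
    apply σeq
    have h1 := congrArg (fun b => Y i * b * Y i) (hx0 i j)
    simp only [← mul_assoc, hYX, one_mul] at h1
    rw [mul_assoc, hXY, mul_one] at h1
    rw [map_add, ιh, h1]
    split_ifs <;> simp
  have τa : ∀ i j, τ i (a' j) = a' j := by
    intro i j
    apply τeq
    rw [ιa, hacen]
  have σa : ∀ i j, σ i (a' j) = a' j := by
    intro i j
    apply σeq
    rw [ιa, hacen]
  obtain ⟨U, hU⟩ : ∃ U : Fin n → C, ∀ i, U i = h i ^ n +
    ∑ K : Fin n, (-1 : C) ^ (K : ℕ) * a' K * h i ^ (n - 1 - (K : ℕ)) := ⟨_, fun _ => rfl⟩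
  obtain ⟨P, hP⟩ : ∃ P : Fin n → C, ∀ i,
    P i = τ i (∏ m ∈ univ.filter (fun m => m < i), v i m 0) := ⟨_, fun _ => rfl⟩
  obtain ⟨Q, hQ⟩ : ∃ Q : Fin n → C, ∀ i,
    Q i = ∏ m ∈ univ.filter (fun m => i < m), v i m 0 := ⟨_, fun _ => rfl⟩
  obtain ⟨R, hR⟩ : ∃ R : Fin n → C, ∀ i, R i = U i * Q i := ⟨_, fun _ => rfl⟩
  obtain ⟨cA, cB, cC, cD, cE⟩ := aux_core h a' v hv τ σ τh σh τa σa U P Q R hU hP hQ hR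
  have hinv : ∀ (i : Fin n) (s : Finset (Fin n)), i ∉ s →
      Ring.inverse (oprod s (fun m => hw i - hw m)) = ι (∏ m ∈ s, v i m 0) := by
    intro i s hs
    refine aux_inv_s9 ι (∏ m ∈ s, (h i - h m)) _ _ ?_ ?_
    · exact aux_oprod ι s _ _ fun m _ => by rw [map_sub, ιh, ιh]
    · rw [← Finset.prod_mul_distrib]
      refine Finset.prod_eq_one fun m hm => ?_
      have := hv i m 0 (fun e => hs (e ▸ hm))
      simpa using this
  have Zf : ∀ i, Zd i = ι (P i) * X i := by
    intro i
    rw [hZ]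
    simp only
    rw [hinv i _ (by simp), ιx, hP]
  have Df : ∀ i, Dd i = ι (R i) * Y i := by
    intro i
    rw [hD]
    simp only
    rw [hinv i _ (by simp), hR, map_mul, hU, hQ]
    simp only [map_add, map_sum, map_mul, map_pow, map_neg, map_one, ιh, ιa]
    rfl
  have hvinv : ∀ i j (m : ℤ) (b : B), i ≠ j → b = hw i - hw j + (m : B) →
      Ring.inverse b = ι (v i j m) := by
    intro i j m b hij hb
    refine aux_inv_s9 ι (h i - h j + m) _ _ ?_ (hv i j m hij)
    rw [hb]; simp [ιh]
  have ZZ : ∀ i j, Zd i * Zd j = ι (P i * τ i (P j)) * (X i * X j) := by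
    intro i j
    rw [Zf, Zf, map_mul, mul_assoc (ι (P i)), ← mul_assoc (X i), ιx]
    simp only [mul_assoc]
  have DDm : ∀ i j, Dd i * Dd j = ι (R i * σ i (R j)) * (Y i * Y j) := by
    intro i j
    rw [Df, Df, map_mul, mul_assoc (ι (R i)), ← mul_assoc (Y i), ιy]
    simp only [mul_assoc]
  have ZD : ∀ i j, Zd i * Dd j = ι (P i * τ i (R j)) * (X i * Y j) := by
    intro i j
    rw [Zf, Df, map_mul, mul_assoc (ι (P i)), ← mul_assoc (X i), ιx]
    simp only [mul_assoc]
  have DZ : ∀ i j, Dd i * Zd j = ι (R i * σ i (P j)) * (Y i * X j) := by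
    intro i j
    rw [Df, Zf, map_mul, mul_assoc (ι (R i)), ← mul_assoc (Y i), ιy]
    simp only [mul_assoc]
  refine ⟨hhc, ?_, ?_, ?_, ?_, ?_, ?_, ?_⟩
  · intro i j
    have e : hw i + (if i = j then 1 else 0) = ι (h i + if i = j then 1 else 0) := by
      rw [map_add, ιh]; split_ifs <;> simp
    rw [e, Zf, mul_assoc, ιx, ← ιh, ← mul_assoc, ← mul_assoc, ← map_mul, ← map_mul]
    congr 2
    rw [map_add, τh]
    by_cases hij : i = j
    · subst hij; simp [mul_comm]
    · simp [hij, Ne.symm hij, mul_comm]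
  · intro i j
    have e : hw i - (if i = j then 1 else 0) = ι (h i - if i = j then 1 else 0) := by
      rw [map_sub, ιh]; split_ifs <;> simp
    rw [e, Df, mul_assoc, ιy, ← ιh, ← mul_assoc, ← mul_assoc, ← map_mul, ← map_mul]
    congr 2
    rw [map_sub, σh]
    by_cases hij : i = j
    · subst hij; simp [mul_comm]
    · simp [hij, Ne.symm hij, mul_comm]
  · intro i j hij
    rw [hvinv i j 0 _ hij.ne (by simp), ZZ, ZZ, cA i j hij, hXX j i]
    simp only [mul_assoc, map_mul, map_add, map_sub, map_one, ιh]
  · intro i j hij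
    rw [hvinv i j 0 _ hij.ne (by simp), DDm, DDm, cB i j hij, hYY j i]
    simp only [mul_assoc, map_mul, map_sub, map_one, ιh]
  · intro i j hij
    rw [ZD, DZ, cC i j hij, hYXc]
  · intro i j hij
    rw [hvinv i j (-1) _ hij.ne' (by push_cast; abel), ZD, DZ, cD i j hij, hYXc]
    simp only [mul_assoc, map_mul, map_sub, map_pow, map_ofNat, ιh]
  · intro i
    rw [ZD, cE i, hXY, mul_one, map_sub, map_one, map_sum]
    congr 1
    refine Finset.sum_congr rfl fun j _ => ?_
    rw [DZ, hYX, mul_one, map_mul]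
    congr 1
    by_cases hij : i = j
    · subst hij; simp
    · rw [if_neg hij, hvinv j i 1 _ (Ne.symm hij) (by push_cast; abel)]
end

section
/- Assume in addition that each Z^i is invertible in A, and set X^i = Z^i ψ'_i and D_i = (ψ'_i)^{−1} h̃_i (Z^i)^{−1}. Then the elements X^1, …, X^n, D_1, …, D_n satisfy the Weyl algebra relations: X^i X^j = X^j X^i, D_i D_j = D_j D_i, and D_i X^j − X^j D_i = δ_{ij} for all i, j; moreover D_i X^i = h̃_i. (This expresses that the map μ from the localized Weyl algebra to the localized ring of h-deformed differential operators respects the defining relations.) -/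
open Finset

theorem aux_psi {A : Type*} [Ring A] {n : ℕ} (h : Fin n → A) (z : A) (i j : Fin n)
    (hcomm : ∀ i j, h i * h j = h j * h i) (l : List (Fin n)) (hl : l.Nodup) (hi : i ∈ l)
    (hz : ∀ m, m ≠ i → Commute (h j - h m) z)
    (hc : (h j - h i) * z = z * (h j - h i - 1)) :
    (l.map fun m => h j - h m).prod * z * (h j - h i) =
      z * (l.map fun m => h j - h m).prod * (h j - h i - 1) := by
  obtain ⟨s, t, rfl⟩ := List.append_of_mem hi
  have hs : i ∉ s := by
    intro hs
    have := List.nodup_append.1 hl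
    exact this.2.2 i hs i (by simp) rfl
  have ht : i ∉ t := by
    have := (List.nodup_append.1 hl).2.1
    exact (List.nodup_cons.1 this).1
  have key : ∀ u : List (Fin n), i ∉ u → Commute ((u.map fun m => h j - h m).prod) z := by
    intro u hu
    apply Commute.list_prod_left
    intro x hx
    obtain ⟨m, hm, rfl⟩ := List.mem_map.1 hx
    exact hz m (fun e => hu (e ▸ hm))
  have hcc : ∀ a b c d, Commute (h a - h b) (h c - h d) := fun a b c d =>
    ((show Commute (h a) (h c) from hcomm a c).sub_right (hcomm a d)).sub_left
      ((show Commute (h b) (h c) from hcomm b c).sub_right (hcomm b d))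
  have key2 : ∀ u : List (Fin n), Commute ((u.map fun m => h j - h m).prod) (h j - h i) := by
    intro u
    apply Commute.list_prod_left
    intro x hx
    obtain ⟨m, hm, rfl⟩ := List.mem_map.1 hx
    exact hcc _ _ _ _
  have k1 := (key s hs).eq
  have k2 := (key t ht).eq
  have k4 := (key2 t).eq
  have k5 := ((key2 t).sub_right (Commute.one_right _)).eq
  simp only [List.map_append, List.map_cons, List.prod_append, List.prod_cons]
  generalize (s.map fun m => h j - h m).prod = S at *
  generalize (t.map fun m => h j - h m).prod = T at *
  have k6 : (h j - h i - 1) * (h j - h i) = (h j - h i) * (h j - h i - 1) := by noncomm_ring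
  generalize h j - h i - 1 = c' at *
  generalize h j - h i = c at *
  calc S * (c * T) * z * c = S * c * (T * z) * c := by noncomm_ring
    _ = S * (c * z) * (T * c) := by rw [k2]; noncomm_ring
    _ = (S * z) * (c' * c) * T := by rw [hc, k4]; noncomm_ring
    _ = z * S * c * (c' * T) := by rw [k1, k6]; noncomm_ring
    _ = z * (S * (c * T)) * c' := by rw [← k5]; noncomm_ring

theorem stmt11 {k A : Type*} [Field k] [CharZero k] [Ring A] [Algebra k A]
    {n : ℕ} (hn : 1 ≤ n) (h Z D : Fin n → A)
    (hcomm : ∀ i j, h i * h j = h j * h i)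
    (hunit : ∀ (i j : Fin n) (m : ℤ), i ≠ j → IsUnit (h i - h j + (m : A)))
    (hhZ : ∀ i j, h i * Z j = Z j * (h i + if i = j then 1 else 0))
    (hhD : ∀ i j, h i * D j = D j * (h i - if i = j then 1 else 0))
    (hZZ : ∀ i j, i < j →
      Z i * Z j = (h i - h j + 1) * Ring.inverse (h i - h j) * (Z j * Z i))
    (hDD : ∀ i j, i < j →
      D i * D j = (h i - h j - 1) * Ring.inverse (h i - h j) * (D j * D i))
    (hZD : ∀ i j, i < j → Z i * D j = D j * Z i)
    (hZD' : ∀ i j, j < i → Z i * D j =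
      (h i - h j) * (h i - h j - 2) * (Ring.inverse (h i - h j - 1)) ^ 2 * (D j * Z i))
    (hZDdiag : ∀ i, Z i * D i =
      (∑ j, Ring.inverse (1 - (h i - h j)) * (D j * Z j)) - 1)
    (hZunit : ∀ i, IsUnit (Z i)) :
    ∀ X D' : Fin n → A,
      X = (fun i => Z i * oprod (Finset.univ.filter fun m => m < i) (fun m => h i - h m)) →
      D' = (fun i => Ring.inverse (oprod (Finset.univ.filter fun m => m < i) (fun m => h i - h m)) *
            h i * Ring.inverse (Z i)) →
      (∀ i j, X i * X j = X j * X i) ∧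
      (∀ i j, D' i * D' j = D' j * D' i) ∧
      (∀ i j, D' i * X j - X j * D' i = if i = j then (1 : A) else 0) ∧
      (∀ i, D' i * X i = h i) := by
  intro X D' hX hD
  have cZ : ∀ i j, i ≠ j → Commute (h i) (Z j) := by
    intro i j hij
    have := hhZ i j
    rw [if_neg hij, add_zero] at this
    exact this
  have hZs : ∀ i, h i * Z i = Z i * (h i + 1) := by
    intro i
    simpa using hhZ i i
  have hcc : ∀ a b c, Commute (h a) (h b - h c) := fun a b c =>
    (show Commute (h a) (h b) from hcomm a b).sub_right (hcomm a c)
  obtain ⟨P, hP⟩ : ∃ P : Fin n → A, P = fun i =>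
      oprod (Finset.univ.filter fun m => m < i) (fun m => h i - h m) := ⟨_, rfl⟩
  have Pcomm : ∀ (x : A) i, (∀ m, m < i → Commute x (h i - h m)) → Commute x (P i) := by
    intro x i hx
    rw [hP]
    apply Commute.list_prod_right
    intro y hy
    obtain ⟨m, hm, rfl⟩ := List.mem_map.1 hy
    exact hx m (by simpa using hm)
  have hPh : ∀ i j, Commute (h i) (P j) := fun i j => Pcomm _ _ fun m _ => hcc _ _ _
  have hPP : ∀ i j, Commute (P i) (P j) := fun i j => Pcomm _ _ fun m _ =>
    ((hPh j i).symm.sub_right (hPh m i).symm)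
  have hPu : ∀ i, IsUnit (P i) := by
    intro i
    rw [hP]
    apply List.prod_isUnit
    intro y hy
    obtain ⟨m, hm, rfl⟩ := List.mem_map.1 hy
    have hm' : m < i := by simpa using hm
    simpa using hunit i m 0 hm'.ne'
  have hX' : ∀ i, X i = Z i * P i := by intro i; rw [hX, hP]
  have hD' : ∀ i, D' i = Ring.inverse (P i) * h i * Ring.inverse (Z i) := by
    intro i; rw [hD, hP]
  clear hX hD
  have hlt : ∀ i j, i < j → X i * X j = X j * X i := by
    intro i j hij
    have hu : IsUnit (h j - h i) := by simpa using hunit j i 0 hij.ne'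
    have hu' : IsUnit (h i - h j) := by simpa using hunit i j 0 hij.ne
    have e1 : P i * Z j = Z j * P i := (Pcomm (Z j) i fun m hm =>
      ((cZ i j hij.ne).symm.sub_right (cZ m j (hm.trans hij).ne).symm)).symm.eq
    have hji := (cZ j i hij.ne').eq
    have hij' := (cZ i j hij.ne).eq
    have e2 : P j * Z i * (h j - h i) = Z i * P j * (h j - h i - 1) := by
      rw [hP]
      apply aux_psi h (Z i) i j hcomm
      · exact Finset.sort_nodup _ _
      · simpa using hij
      · intro m hm
        exact (cZ j i hij.ne').sub_left (cZ m i hm)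
      · rw [sub_mul, hji, hZs]; noncomm_ring
    have e3 : (h i - h j) * (Z i * Z j) = (h i - h j + 1) * (Z j * Z i) := by
      rw [hZZ i j hij, ← mul_assoc]
      congr 1
      have : (h i - h j) * (h i - h j + 1) = (h i - h j + 1) * (h i - h j) := by noncomm_ring
      rw [← mul_assoc, this, mul_assoc, Ring.mul_inverse_cancel _ hu', mul_one]
    have e4 : (h i - h j) * (Z i * Z j) = (Z i * Z j) * (h i - h j) := by
      have a1 : h i * (Z i * Z j) = Z i * Z j * (h i + 1) := by
        rw [← mul_assoc, hZs, mul_assoc, add_mul, hij']; noncomm_ring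
      have a2 : h j * (Z i * Z j) = Z i * Z j * (h j + 1) := by
        rw [← mul_assoc, hji, mul_assoc, hZs]; noncomm_ring
      rw [sub_mul, a1, a2]; noncomm_ring
    have e5 : (h i - h j + 1) * (Z j * Z i) = (Z j * Z i) * (h i - h j + 1) := by
      have a1 : h i * (Z j * Z i) = Z j * Z i * (h i + 1) := by
        rw [← mul_assoc, hij', mul_assoc, hZs]; noncomm_ring
      have a2 : h j * (Z j * Z i) = Z j * Z i * (h j + 1) := by
        rw [← mul_assoc, hZs, mul_assoc, add_mul, hji]; noncomm_ring
      rw [add_mul, sub_mul, a1, a2]; noncomm_ring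
    have e6 : Z i * Z j * (h j - h i) = Z j * Z i * (h j - h i - 1) := by
      have : Z i * Z j * (h i - h j) = Z j * Z i * (h i - h j + 1) := by
        rw [← e4, e3, e5]
      have a : h j - h i = -(h i - h j) := by abel
      have b : h j - h i - 1 = -(h i - h j + 1) := by abel
      rw [b, a, mul_neg, mul_neg, this]
    have c1 : ∀ l, P l * (h j - h i) = (h j - h i) * P l := fun l =>
      ((hPh j l).symm.sub_right (hPh i l).symm).eq
    have c2 : ∀ l, P l * (h j - h i - 1) = (h j - h i - 1) * P l := fun l =>
      (((hPh j l).symm.sub_right (hPh i l).symm).sub_right (Commute.one_right _)).eq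
    apply hu.mul_right_cancel
    rw [hX', hX']
    have c3 := (hPP i j).eq
    generalize h j - h i - 1 = c' at *
    generalize h j - h i = c at *
    calc Z i * P i * (Z j * P j) * c = Z i * (P i * Z j) * (P j * c) := by noncomm_ring
      _ = Z i * Z j * (P i * c) * P j := by rw [e1, c1]; noncomm_ring
      _ = (Z i * Z j * c) * (P i * P j) := by rw [c1]; noncomm_ring
      _ = Z j * Z i * (c' * P j) * P i := by rw [e6, c3]; noncomm_ring
      _ = Z j * (Z i * P j * c') * P i := by rw [← c2]; noncomm_ring
      _ = Z j * P j * Z i * (c * P i) := by rw [← e2]; noncomm_ring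
      _ = Z j * P j * (Z i * P i) * c := by rw [← c1]; noncomm_ring
  have hXX : ∀ i j, Commute (X i) (X j) := by
    intro i j
    rcases lt_trichotomy i j with H | H | H
    · exact hlt i j H
    · rw [H]
    · exact (hlt j i H).symm
  have hhX : ∀ i j, i ≠ j → Commute (h i) (X j) := by
    intro i j hij
    rw [hX']
    exact (cZ i j hij).mul_right (hPh i j)
  have hXu : ∀ i, IsUnit (X i) := by
    intro i; rw [hX']; exact (hZunit i).mul (hPu i)
  have hDX : ∀ i, D' i * X i = h i := by
    intro i
    rw [hD', hX']
    calc Ring.inverse (P i) * h i * Ring.inverse (Z i) * (Z i * P i)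
        = Ring.inverse (P i) * h i * (Ring.inverse (Z i) * Z i) * P i := by noncomm_ring
      _ = Ring.inverse (P i) * (h i * P i) := by
        rw [Ring.inverse_mul_cancel _ (hZunit i)]; noncomm_ring
      _ = h i := by
        rw [(hPh i i).eq, ← mul_assoc, Ring.inverse_mul_cancel _ (hPu i), one_mul]
  have hDX2 : ∀ i j, i ≠ j → Commute (D' i) (X j) := by
    intro i j hij
    apply (hXu i).mul_right_cancel
    rw [mul_assoc, (hXX j i).eq, ← mul_assoc, hDX, mul_assoc, hDX, (hhX i j hij).eq]
  have hhDc : ∀ i j, i ≠ j → Commute (h i) (D' j) := by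
    intro i j hij
    apply (hXu j).mul_right_cancel
    rw [mul_assoc, hDX, mul_assoc, (hhX i j hij).eq, ← mul_assoc, hDX, hcomm]
  refine ⟨fun i j => (hXX i j).eq, ?_, ?_, hDX⟩
  · intro i j
    by_cases hij : i = j
    · rw [hij]
    · apply (hXu j).mul_right_cancel
      rw [mul_assoc, hDX, mul_assoc, (hDX2 i j hij).eq, ← mul_assoc, hDX,
        (hhDc j i (Ne.symm hij)).eq]
  · intro i j
    by_cases hij : i = j
    · subst hij
      rw [if_pos rfl, hDX, sub_eq_iff_eq_add]
      apply (hXu i).mul_right_cancel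
      rw [add_mul, mul_assoc, hDX, hX', ← mul_assoc, hZs, mul_assoc, mul_assoc, (hPh i i).symm.eq]
      noncomm_ring
    · rw [if_neg hij, (hDX2 i j hij).eq, sub_self]
end
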